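/- arXiv:2201.08376 — 4 statements merged into one kernel-verified Lean document; each statement's English description precedes it below -/
import Mathlib

section
/- Let q = p^n > 2 with p prime, let U be a proper F_p-subspace of the finite field F_q, and let σ : F_q → F_q be a function. If the set of directions D_σ = {(σ(x) − σ(y))/(x − y) : x, y ∈ F_q, x ≠ y} is contained in U, then σ is affine, i.e., there exist a, b ∈ F_q such that σ(x) = a·x + b for all x ∈ F_q. -/
lemma aux_pow_pair_le (p a b c d : ℕ) (hp : 2 ≤ p) (had : a ≤ d) (hbc : b ≤ c)
    (h : p ^ a + p ^ d = p ^ b + p ^ c) : a = b ∧ d = c := by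
  have key : ∀ a b c d : ℕ, a ≤ d → p ^ a + p ^ d = p ^ b + p ^ c → ¬ d < c := by
    intro a b c d had h hlt
    have h1 : p ^ a ≤ p ^ d := Nat.pow_le_pow_right (by omega) had
    have h2 : p ^ (d + 1) ≤ p ^ c := Nat.pow_le_pow_right (by omega) hlt
    have h3 : 0 < p ^ b := Nat.pow_pos (by omega)
    rw [pow_succ] at h2
    have h4 : p ^ d * 2 ≤ p ^ d * p := Nat.mul_le_mul_left _ hp
    omega
  have hdc : d = c := by
    have h1 := key a b c d had h
    have h2 := key b a d c hbc h.symm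
    omega
  subst hdc
  exact ⟨Nat.pow_right_injective hp (by simpa using h), rfl⟩

lemma aux_pow_pair (p a b c d : ℕ) (hp : 2 ≤ p) (hab : d ≠ c)
    (h : p ^ a + p ^ d = p ^ b + p ^ c) : a = c ∧ d = b := by
  rcases le_total a d with h1 | h1 <;> rcases le_total b c with h2 | h2
  · have := aux_pow_pair_le p a b c d hp h1 h2 h
    omega
  · have := aux_pow_pair_le p a c b d hp h1 h2 (by omega)
    omega
  · have := aux_pow_pair_le p d b c a hp h1 h2 (by omega)
    omega
  · have := aux_pow_pair_le p d c b a hp h1 h2 (by omega)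
    omega

lemma aux_arith (p n i j i0 k : ℕ) (hp : 2 ≤ p) (hi : i < n) (hj : j < n) (hi0 : i0 < n)
    (hkn : k < n) (hk : k ≠ 0)
    (hd : ((p : ℤ) ^ n - 1) ∣ ((p : ℤ) ^ (i + j) + p ^ i0) - (p ^ i + p ^ (i0 + k))) :
    i = i0 ∧ j = k := by
  have hn : 0 < n := by omega
  have red : ∀ m : ℕ, (p : ℤ) ^ m ≡ (p : ℤ) ^ (m % n) [ZMOD ((p : ℤ) ^ n - 1)] := by
    intro m
    conv_lhs => rw [← Nat.div_add_mod m n, pow_add, pow_mul]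
    have h1 : (p : ℤ) ^ n ≡ 1 [ZMOD ((p : ℤ) ^ n - 1)] :=
      (Int.modEq_iff_dvd.2 (by simp)).symm
    simpa using (h1.pow (m / n)).mul_right ((p : ℤ) ^ (m % n))
  have h1 : ((p : ℤ) ^ i + p ^ ((i0 + k) % n)) ≡ ((p : ℤ) ^ ((i + j) % n) + p ^ i0)
      [ZMOD ((p : ℤ) ^ n - 1)] := by
    have h2 : ((p : ℤ) ^ i + p ^ (i0 + k)) ≡ ((p : ℤ) ^ (i + j) + p ^ i0)
      [ZMOD ((p : ℤ) ^ n - 1)] := Int.modEq_iff_dvd.2 hd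
    exact ((red (i0 + k)).add_left _).symm.trans (h2.trans ((red (i + j)).add_right _))
  have hbd : ∀ m < n, 1 ≤ (p : ℤ) ^ m ∧ 2 * (p : ℤ) ^ m ≤ (p : ℤ) ^ n := by
    intro m hm
    have hp' : (2 : ℤ) ≤ p := by exact_mod_cast hp
    refine ⟨one_le_pow₀ (by omega), ?_⟩
    calc 2 * (p : ℤ) ^ m ≤ p * (p : ℤ) ^ m := by
          gcongr
      _ = (p : ℤ) ^ (m + 1) := by ring
      _ ≤ (p : ℤ) ^ n := pow_le_pow_right₀ (by omega) hm
  have he : ((p : ℤ) ^ ((i + j) % n) + p ^ i0) = ((p : ℤ) ^ i + p ^ ((i0 + k) % n)) := by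
    have h2 := Int.modEq_iff_dvd.1 h1
    have b1 := hbd i hi
    have b2 := hbd i0 hi0
    have b3 := hbd _ (Nat.mod_lt (i + j) hn)
    have b4 := hbd _ (Nat.mod_lt (i0 + k) hn)
    have := Int.eq_zero_of_abs_lt_dvd h2 (by rw [abs_lt]; constructor <;> linarith)
    linarith
  have he' : p ^ ((i + j) % n) + p ^ i0 = p ^ i + p ^ ((i0 + k) % n) := by exact_mod_cast he
  have hne : i0 ≠ (i0 + k) % n := by
    rcases lt_or_ge (i0 + k) n with h | h
    · rw [Nat.mod_eq_of_lt h]; omega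
    · rw [Nat.mod_eq_sub_mod h, Nat.mod_eq_of_lt (by omega)]; omega
  obtain ⟨h3, h4⟩ := aux_pow_pair p _ _ _ _ hp hne he'
  subst h4
  refine ⟨rfl, ?_⟩
  rcases lt_or_ge (i0 + k) n with h | h <;> rcases lt_or_ge (i0 + j) n with h' | h'
  · rw [Nat.mod_eq_of_lt h, Nat.mod_eq_of_lt h'] at h3; omega
  · rw [Nat.mod_eq_of_lt h, Nat.mod_eq_sub_mod h', Nat.mod_eq_of_lt (by omega)] at h3; omega
  · rw [Nat.mod_eq_of_lt h', Nat.mod_eq_sub_mod h, Nat.mod_eq_of_lt (by omega)] at h3; omega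
  · rw [Nat.mod_eq_sub_mod h', Nat.mod_eq_sub_mod h, Nat.mod_eq_of_lt (by omega),
      Nat.mod_eq_of_lt (by omega)] at h3; omega

lemma aux_linear_rep (p : ℕ) [Fact p.Prime] (F : Type*) [Field F] [Fintype F]
    [Algebra (ZMod p) F] (g : F →ₗ[ZMod p] F) :
    ∃ c : ℕ → F, ∀ x, g x = ∑ i ∈ Finset.range (Module.finrank (ZMod p) F), c i * x ^ p ^ i := by
  classical
  let b := Module.finBasis (ZMod p) F
  refine ⟨fun i => ∑ l, g (b.traceDual l) * (b l) ^ p ^ i, fun x => ?_⟩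
  have h1 : x = ∑ l, (Algebra.trace (ZMod p) F (x * b l)) • b.traceDual l := by
    conv_lhs => rw [← b.traceDual.sum_repr x]
    simp [Module.Basis.traceDual_repr_apply, Algebra.traceForm_apply]
  conv_lhs => rw [h1]
  simp only [map_sum, map_smul, Finset.sum_mul]
  rw [Finset.sum_comm]
  refine Finset.sum_congr rfl fun l _ => ?_
  rw [Algebra.smul_def, FiniteField.algebraMap_trace_eq_sum_pow, Finset.sum_mul]
  refine Finset.sum_congr rfl fun i _ => ?_
  simp only [Nat.card_eq_fintype_card, ZMod.card]
  ring

lemma aux_additive (p : ℕ) [Fact p.Prime] (F : Type*) [Field F] [Fintype F]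
    [Algebra (ZMod p) F] (U : Submodule (ZMod p) F) (hU : U ≠ ⊤)
    (f : F →ₗ[ZMod p] F) (hf : ∀ h : F, h ≠ 0 → f h / h ∈ U) :
    ∃ a : F, ∀ x, f x = a * x := by
  classical
  have : CharP F p := charP_of_injective_algebraMap (algebraMap (ZMod p) F).injective p
  obtain ⟨ψ, hψ0, hψ⟩ := Submodule.exists_le_ker_of_lt_top U (lt_top_iff_ne_top.2 hU)
  obtain ⟨a, ha⟩ := aux_linear_rep p F f
  obtain ⟨c, hc⟩ := aux_linear_rep p F ((Algebra.linearMap (ZMod p) F).comp ψ)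
  set n := Module.finrank (ZMod p) F with hn
  have hp2 : 2 ≤ p := (Fact.out : p.Prime).two_le
  have hcard : Fintype.card F = p ^ n := by
    rw [Module.card_eq_pow_finrank (K := ZMod p), ZMod.card]
  have hcard2 : 2 ≤ Fintype.card F := Fintype.one_lt_card
  have hci : ∃ i0 < n, c i0 ≠ 0 := by
    by_contra! hcon
    apply hψ0
    ext x
    have := hc x
    rw [Finset.sum_eq_zero (fun i hi => by rw [hcon i (Finset.mem_range.1 hi), zero_mul])] at this
    simpa using this
  obtain ⟨i0, hi0, hci0⟩ := hci
  have hrel : ∀ h : Fˣ, ∑ i ∈ Finset.range n, ∑ j ∈ Finset.range n,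
      c i * a j ^ p ^ i * ((h : F) ^ p ^ (i + j) * ((h : F)⁻¹) ^ p ^ i) = 0 := by
    intro h
    have h1 : ψ (f h / h) = 0 := hψ (hf h h.ne_zero)
    have h2 := hc (f h / h)
    rw [LinearMap.comp_apply, h1, map_zero] at h2
    rw [h2]
    refine Finset.sum_congr rfl fun i _ => ?_
    rw [ha h, div_eq_mul_inv, mul_pow, sum_pow_char_pow, Finset.sum_mul, Finset.mul_sum]
    refine Finset.sum_congr rfl fun j _ => ?_
    rw [mul_pow, ← pow_mul, ← pow_add, add_comm j i]
    ring
  have hak : ∀ k < n, k ≠ 0 → a k = 0 := by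
    intro k hk hk0
    have hinv : ∀ h : Fˣ, (h : F)⁻¹ = (h : F) ^ (Fintype.card F - 2) := by
      intro h
      apply inv_eq_of_mul_eq_one_left
      rw [← pow_succ, show Fintype.card F - 2 + 1 = Fintype.card F - 1 by omega]
      exact FiniteField.pow_card_sub_one_eq_one _ h.ne_zero
    have hterm : ∀ i ∈ Finset.range n, ∀ j ∈ Finset.range n,
        ∑ h : Fˣ, ((h : F) ^ p ^ (i + j) * ((h : F)⁻¹) ^ p ^ i) *
          ((h : F) ^ p ^ i0 * ((h : F)⁻¹) ^ p ^ (i0 + k)) =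
        if i = i0 ∧ j = k then -1 else 0 := by
      intro i hi j hj
      rw [Finset.mem_range] at hi hj
      have e1 : ∀ h : Fˣ, ((h : F) ^ p ^ (i + j) * ((h : F)⁻¹) ^ p ^ i) *
          ((h : F) ^ p ^ i0 * ((h : F)⁻¹) ^ p ^ (i0 + k)) =
          (h : F) ^ (p ^ (i + j) + p ^ i0 + (Fintype.card F - 2) * (p ^ i + p ^ (i0 + k))) := by
        intro h
        rw [hinv]
        ring
      rw [Finset.sum_congr rfl fun h _ => e1 h]
      have e2 := FiniteField.sum_pow_units F
        (p ^ (i + j) + p ^ i0 + (Fintype.card F - 2) * (p ^ i + p ^ (i0 + k)))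
      push_cast at e2
      rw [e2]
      congr 1
      rw [eq_iff_iff, ← Int.natCast_dvd_natCast]
      have e3 : ((p ^ (i + j) + p ^ i0 + (Fintype.card F - 2) * (p ^ i + p ^ (i0 + k)) : ℕ) : ℤ)
          = ((p : ℤ) ^ (i + j) + p ^ i0 - (p ^ i + p ^ (i0 + k))) +
            ((p : ℤ) ^ n - 1) * (p ^ i + p ^ (i0 + k)) := by
        push_cast [Nat.cast_sub hcard2]
        rw [hcard]
        push_cast
        ring
      have e4 : ((Fintype.card F - 1 : ℕ) : ℤ) = (p : ℤ) ^ n - 1 := by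
        push_cast [Nat.cast_sub (show 1 ≤ Fintype.card F by omega)]
        rw [hcard]
        push_cast
        ring
      rw [e3, e4, dvd_add_left (dvd_mul_right _ _)]
      constructor
      · exact aux_arith p n i j i0 k hp2 hi hj hi0 hk hk0
      · rintro ⟨rfl, rfl⟩
        have : ((p : ℤ) ^ (i + j) + p ^ i - (p ^ i + p ^ (i + j))) = 0 := by ring
        rw [this]
        exact dvd_zero _
    have htot : ∑ h : Fˣ, (∑ i ∈ Finset.range n, ∑ j ∈ Finset.range n,
      c i * a j ^ p ^ i * ((h : F) ^ p ^ (i + j) * ((h : F)⁻¹) ^ p ^ i)) *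
        ((h : F) ^ p ^ i0 * ((h : F)⁻¹) ^ p ^ (i0 + k)) = 0 :=
      Finset.sum_eq_zero fun h _ => by rw [hrel h, zero_mul]
    have htot2 : ∑ i ∈ Finset.range n, ∑ j ∈ Finset.range n,
      c i * a j ^ p ^ i * (if i = i0 ∧ j = k then (-1 : F) else 0) = 0 := by
      refine Eq.trans ?_ htot
      simp only [Finset.sum_mul]
      symm
      rw [Finset.sum_comm]
      refine Finset.sum_congr rfl fun i hi => ?_
      rw [Finset.sum_comm]
      refine Finset.sum_congr rfl fun j hj => ?_
      rw [← hterm i hi j hj, Finset.mul_sum]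
      refine Finset.sum_congr rfl fun h _ => ?_
      ring
    rw [Finset.sum_eq_single_of_mem i0 (Finset.mem_range.2 hi0)
      (by
        intro i _ hne
        apply Finset.sum_eq_zero
        intro j _
        simp [hne]),
      Finset.sum_eq_single_of_mem k (Finset.mem_range.2 hk)
      (by
        intro j _ hne
        simp [hne])] at htot2
    simp only [and_self, if_true, mul_neg, mul_one, neg_eq_zero, mul_eq_zero] at htot2
    rcases htot2 with h | h
    · exact absurd h hci0
    · exact eq_zero_of_pow_eq_zero h
  refine ⟨a 0, fun x => ?_⟩
  have hn0 : 0 < n := Module.finrank_pos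
  rw [ha x, Finset.sum_eq_single_of_mem 0 (Finset.mem_range.2 hn0)
    (fun j hj hne => by rw [hak j (Finset.mem_range.1 hj) hne, zero_mul])]
  simp

lemma aux_poly (p : ℕ) [Fact p.Prime] (F : Type*) [Field F] [Fintype F]
    [Algebra (ZMod p) F] (U : Submodule (ZMod p) F) (hU : U ≠ ⊤) :
    ∀ (N : ℕ) (P : Polynomial F), P.natDegree ≤ N →
    (∀ x y : F, x ≠ y → (P.eval x - P.eval y) / (x - y) ∈ U) →
    ∃ a b : F, ∀ x : F, P.eval x = a * x + b := by
  intro N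
  induction N with
  | zero =>
    intro P hP _
    rw [Polynomial.eq_C_of_natDegree_le_zero hP]
    exact ⟨0, P.coeff 0, fun x => by simp⟩
  | succ N ih =>
    intro P hP hdir
    have hΔ : ∀ t : F, ∃ a b : F, ∀ x : F, P.eval (x + t) - P.eval x = a * x + b := by
      intro t
      by_cases h0 : P.natDegree = 0
      · rw [Polynomial.eq_C_of_natDegree_eq_zero h0]
        exact ⟨0, 0, fun x => by simp⟩
      have hev : ∀ x, (Polynomial.taylor t P - P).eval x = P.eval (x + t) - P.eval x := by
        intro x
        simp [Polynomial.taylor_eval]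
      have hdeg : (Polynomial.taylor t P - P).natDegree ≤ N := by
        by_cases hz : Polynomial.taylor t P - P = 0
        · simp [hz]
        have hP0 : P ≠ 0 := by
          rintro rfl
          simp at h0
        have := Polynomial.degree_sub_lt_left (Polynomial.degree_taylor P t)
          (by rwa [Ne, Polynomial.taylor_eq_zero]) (Polynomial.leadingCoeff_taylor (r := t) (f := P))
        have h3 := Polynomial.natDegree_lt_natDegree hz
          (this.trans_eq (Polynomial.degree_taylor P t))
        omega
      obtain ⟨a, b, hab⟩ := ih _ hdeg (by
        intro x y hxy
        have h1 := hdir (x + t) (y + t) (by simpa using hxy)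
        have h2 := hdir x y hxy
        have h3 := U.sub_mem h1 h2
        rw [hev, hev]
        convert h3 using 1
        rw [add_sub_add_right_eq_sub, ← sub_div]
        ring)
      exact ⟨a, b, fun x => by rw [← hev, hab]⟩
    choose α β hαβ using hΔ
    set f : F → F := fun x => P.eval x - P.eval 0 with hf
    have hB : ∀ x t, f (x + t) = f x + f t + α t * x := by
      intro x t
      have h1 := hαβ t x
      have h2 := hαβ t 0
      simp only [hf]
      simp only [zero_add, mul_zero] at h2
      linear_combination h1 - h2
    have hα : ∀ t, α t = α 1 * t := by
      intro t
      have h1 := hB 1 t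
      have h2 := hB t 1
      rw [add_comm t 1] at h2
      linear_combination h2 - h1
    have hmem : ∀ x h, h ≠ 0 → f h / h + α 1 * x ∈ U := by
      intro x h hh
      have h1 := hdir (x + h) x (by simpa using hh)
      convert h1 using 1
      have h2 := hB x h
      rw [hα h] at h2
      rw [add_sub_cancel_left]
      field_simp
      simp only [hf] at h2 ⊢
      linear_combination -h2
    have ha : α 1 = 0 := by
      by_contra hne
      apply hU
      rw [eq_top_iff]
      intro z _
      have h1 := U.sub_mem (hmem (z / α 1) 1 one_ne_zero) (hmem 0 1 one_ne_zero)
      convert h1 using 1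
      field_simp
      ring
    let fa : F →+ F := AddMonoidHom.mk' f (fun x y => by rw [hB, hα, ha]; ring)
    obtain ⟨a, haa⟩ := aux_additive p F U hU (fa.toZModLinearMap p) (fun h hh => by
      have := hmem 0 h hh
      rw [mul_zero, add_zero] at this
      exact this)
    refine ⟨a, P.eval 0, fun x => ?_⟩
    have h1 : f x = a * x := haa x
    simp only [hf] at h1
    linear_combination h1

lemma aux_main (p : ℕ) [Fact p.Prime] (F : Type*) [Field F] [Fintype F]
    [Algebra (ZMod p) F] (U : AddSubgroup F) (hU : U ≠ ⊤) (σ : F → F)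
    (hdir : ∀ x y : F, x ≠ y → (σ x - σ y) / (x - y) ∈ U) :
    ∃ a b : F, ∀ x : F, σ x = a * x + b := by
  classical
  let U' : Submodule (ZMod p) F := AddSubgroup.toZModSubmodule p U
  have hmem : ∀ x, x ∈ U' ↔ x ∈ U := fun x => Iff.rfl
  have hU' : U' ≠ ⊤ := by
    intro h
    apply hU
    rw [eq_top_iff]
    intro x _
    rw [← hmem, h]
    trivial
  let P := Lagrange.interpolate Finset.univ (id : F → F) σ
  have hP : ∀ x, P.eval x = σ x := fun x =>
    Lagrange.eval_interpolate_at_node (v := (id : F → F)) σ (Set.injOn_id _) (Finset.mem_univ x)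
  obtain ⟨a, b, hab⟩ := aux_poly p F U' hU' P.natDegree P le_rfl (fun x y hxy => by
    rw [hP, hP, hmem]
    exact hdir x y hxy)
  exact ⟨a, b, fun x => by rw [← hP, hab]⟩

/-- If the set of directions determined by the graph of `σ : F_q → F_q` is contained in a
proper `F_p`-subspace of `F_q` (where `q = p^n > 2`), then `σ` is affine.
(Note: a module structure over `ZMod p` on a fixed additive group is unique, so the
instance argument `[Module (ZMod p) F]` is the canonical `F_p`-vector space structure.) -/
theorem stmt0 (p n : ℕ) [Fact p.Prime] (F : Type*) [Field F] [Fintype F] [CharP F p]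
    [Module (ZMod p) F]
    (hcard : Fintype.card F = p ^ n) (hq : 2 < Fintype.card F)
    (U : Submodule (ZMod p) F) (hU : U ≠ ⊤)
    (σ : F → F)
    (hdir : ∀ x y : F, x ≠ y → (σ x - σ y) / (x - y) ∈ U) :
    ∃ a b : F, ∀ x : F, σ x = a * x + b := by
  refine @aux_main p _ F _ _ (ZMod.algebra F p) U.toAddSubgroup ?_ σ hdir
  intro h
  apply hU
  rw [eq_top_iff]
  intro x _
  have hx : x ∈ U.toAddSubgroup := by
    rw [h]
    trivial
  exact hx
end

section
/- Let q > 9 be odd and let U be an intersecting family of polynomials over F_q of degree at most 2 with |U| = q^2 − ε, where ε < q·√q/4 − 3q/8 − √q/8. Then the graphs of the polynomials in U share a common point; that is, there exist α, β ∈ F_q such that f(α) = β for every f ∈ U. -/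
open Polynomial

section helpers
set_option linter.unusedSectionVars false
variable {F : Type*} [Field F] [Fintype F] [DecidableEq F]

def ev10 (v : F × F × F) (x : F) : F := v.1 * x ^ 2 + v.2.1 * x + v.2.2

lemma ev10_add (v w : F × F × F) (x : F) : ev10 (v + w) x = ev10 v x + ev10 w x := by
  simp [ev10]; ring

lemma ev10_sub (v w : F × F × F) (x : F) : ev10 (v - w) x = ev10 v x - ev10 w x := by
  simp [ev10]; ring

open Classical in
lemma nonsq_card (hodd : Odd (Fintype.card F)) :
    (Finset.univ.filter (fun z : F => ¬ IsSquare z)).card * 2 + 1 = Fintype.card F := by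
  have h2 : ringChar F ≠ 2 := by
    intro h
    have := FiniteField.even_card_of_char_two h
    rw [Nat.odd_iff] at hodd; omega
  have h0 := quadraticChar_sum_zero h2
  have h1 : ∀ z : F, quadraticChar F z = 1 - (if z = 0 then 1 else 0) - 2 * (if ¬ IsSquare z then 1 else 0) := by
    intro z
    by_cases hz : z = 0
    · subst hz; simp
    · by_cases hs : IsSquare z
      · rw [(quadraticChar_one_iff_isSquare hz).2 hs]; simp [hz, hs]
      · rw [quadraticChar_neg_one_iff_not_isSquare.2 hs]; simp [hz, hs]
  simp_rw [h1] at h0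
  rw [Finset.sum_sub_distrib, Finset.sum_sub_distrib, ← Finset.mul_sum] at h0
  rw [Finset.card_filter]
  simp at h0 ⊢
  zify
  linarith

lemma vanish (D : F → ℝ) (hD : ∑ y, D y = 0) (G : F → F → ℝ) (x1 x2 x3 : F)
    (h12 : x1 ≠ x2) (h13 : x1 ≠ x3) :
    ∑ v : F × F × F, D (ev10 v x1) * G (ev10 v x2) (ev10 v x3) = 0 := by
  set p : F := (x1 - x2) * (x1 - x3) with hp
  have hp0 : p ≠ 0 := mul_ne_zero (sub_ne_zero.2 h12) (sub_ne_zero.2 h13)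
  let w : F → F × F × F := fun c => (c, - c * (x2 + x3), c * (x2 * x3))
  have hw : ∀ c x, ev10 (w c) x = c * ((x - x2) * (x - x3)) := by
    intro c x; simp [ev10, w]; ring
  have key : ∀ c : F, ∑ v : F × F × F, D (ev10 v x1) * G (ev10 v x2) (ev10 v x3)
      = ∑ v : F × F × F, D (ev10 v x1 + c * p) * G (ev10 v x2) (ev10 v x3) := by
    intro c
    rw [← Equiv.sum_comp (Equiv.addRight (w c))]
    refine Finset.sum_congr rfl fun v _ => ?_
    simp [ev10_add, hw, hp]
  have h2 : ∑ c : F, ∑ v : F × F × F, D (ev10 v x1) * G (ev10 v x2) (ev10 v x3) = 0 := by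
    rw [Finset.sum_congr rfl fun c _ => key c, Finset.sum_comm]
    refine Finset.sum_eq_zero fun v _ => ?_
    rw [← Finset.sum_mul]
    have : ∑ c : F, D (ev10 v x1 + c * p) = ∑ y, D y :=
      Equiv.sum_comp ((Equiv.mulRight₀ p hp0).trans (Equiv.addLeft (ev10 v x1))) D
    rw [this, hD, zero_mul]
  rw [Finset.sum_const, nsmul_eq_mul] at h2
  rcases mul_eq_zero.1 h2 with h | h
  · exfalso
    have : (Fintype.card F : ℝ) ≠ 0 := by exact_mod_cast Fintype.card_ne_zero
    exact this h
  · exact h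

lemma diag (φ : F → ℝ) (x : F) :
    ∑ v : F × F × F, φ (ev10 v x) = (Fintype.card F : ℝ) ^ 2 * ∑ y, φ y := by
  rw [Fintype.sum_prod_type]
  have : ∀ a : F, ∑ w : F × F, φ (ev10 (a, w) x) = (Fintype.card F : ℝ) * ∑ y, φ y := by
    intro a
    rw [Fintype.sum_prod_type]
    have : ∀ b : F, ∑ c : F, φ (ev10 (a, b, c) x) = ∑ y, φ y := by
      intro b
      exact Equiv.sum_comp (Equiv.addLeft (a * x ^ 2 + b * x)) φ
    simp [this]
  simp [this]; ring

lemma mom2 (D : F → F → ℝ) (hD : ∀ x, ∑ y, D x y = 0) :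
    ∑ v : F × F × F, (∑ x, D x (ev10 v x)) ^ 2
      = (Fintype.card F : ℝ) ^ 2 * ∑ x, ∑ y, D x y ^ 2 := by
  simp_rw [pow_two (∑ x, D x (ev10 _ x)), Finset.sum_mul_sum]
  rw [Finset.sum_comm, Finset.mul_sum]
  refine Finset.sum_congr rfl fun x _ => ?_
  rw [Finset.sum_comm, Finset.sum_eq_single x]
  · rw [← diag (fun y => D x y ^ 2) x]
    simp [pow_two]
  · intro z _ hz
    exact vanish (D x) (hD x) (fun y _ => D z y) x z z hz.symm hz.symm
  · simp

lemma mom3 (D : F → F → ℝ) (hD : ∀ x, ∑ y, D x y = 0) :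
    ∑ v : F × F × F, (∑ x, D x (ev10 v x)) ^ 3
      = (Fintype.card F : ℝ) ^ 2 * ∑ x, ∑ y, D x y ^ 3 := by
  have e : ∀ v : F × F × F, (∑ x, D x (ev10 v x)) ^ 3
      = ∑ x, ∑ z, ∑ w, D x (ev10 v x) * (D z (ev10 v z) * D w (ev10 v w)) := by
    intro v
    rw [pow_succ', pow_two, Finset.sum_mul_sum, Finset.sum_mul]
    refine Finset.sum_congr rfl fun x _ => ?_
    simp_rw [Finset.mul_sum]
  simp_rw [e]
  rw [Finset.sum_comm, Finset.mul_sum]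
  refine Finset.sum_congr rfl fun x _ => ?_
  rw [Finset.sum_comm, Finset.sum_eq_single x]
  · rw [Finset.sum_comm, Finset.sum_eq_single x]
    · rw [← diag (fun y => D x y ^ 3) x]
      refine Finset.sum_congr rfl fun v _ => ?_
      ring
    · intro w _ hw
      rw [← vanish (D w) (hD w) (fun y _ => D x y * D x y) w x x hw hw]
      refine Finset.sum_congr rfl fun v _ => ?_
      ring
    · simp
  · intro z _ hz
    rw [Finset.sum_comm]
    refine Finset.sum_eq_zero fun w _ => ?_
    by_cases hw : w = x
    · subst hw
      rw [← vanish (D z) (hD z) (fun y _ => D w y * D w y) z w w hz hz]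
      refine Finset.sum_congr rfl fun v _ => ?_
      ring
    · exact vanish (D x) (hD x) (fun y t => D z y * D w t) x z w (Ne.symm hz) (Ne.symm hw)
  · simp

/-- number of agreements -/
def kk (f g : F × F × F) : ℕ := (Finset.univ.filter (fun x => ev10 f x = ev10 g x)).card

open Classical in
lemma ccount (hodd : Odd (Fintype.card F)) (f g : F × F × F) (hfg : f ≠ g)
    (hx : ∃ x, ev10 f x = ev10 g x) :
    (((Finset.univ ×ˢ (Finset.univ.filter (fun z : F => ¬ IsSquare z))).filter
      (fun p : F × F => ev10 f p.1 - p.2 * f.1 = ev10 g p.1 - p.2 * g.1)).card : ℝ)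
    ≤ ((Finset.univ.filter (fun z : F => ¬ IsSquare z)).card : ℝ) *
      ((kk f g : ℝ) - 1 + if f.1 = g.1 then 1 else 0) := by
  set NS := Finset.univ.filter (fun z : F => ¬ IsSquare z) with hNS
  set S := (Finset.univ ×ˢ NS).filter
      (fun p : F × F => ev10 f p.1 - p.2 * f.1 = ev10 g p.1 - p.2 * g.1) with hS
  obtain ⟨r, hr⟩ := hx
  have hk1 : 1 ≤ kk f g := Finset.card_pos.2 ⟨r, by simp [hr]⟩
  have hk1' : (1 : ℝ) ≤ kk f g := by exact_mod_cast hk1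
  have hm0 : (0 : ℝ) ≤ NS.card := by positivity
  obtain ⟨a, b, c⟩ := f
  obtain ⟨a', b', c'⟩ := g
  simp only [ev10] at hr
  by_cases ha : a = a'
  · subst ha
    have hb : b ≠ b' := by
      rintro rfl
      apply hfg
      have : c = c' := by linear_combination hr
      rw [this]
    have hle : S.card ≤ NS.card := by
      apply Finset.card_le_card_of_injOn (fun p => p.2)
      · intro p hp
        simp [hS] at hp
        exact_mod_cast hp.1
      · rintro ⟨s, n⟩ hp ⟨s', n'⟩ hp' h
        simp [hS, ev10] at hp hp' h
        have e1 : (b - b') * (s - s') = 0 := by linear_combination hp.2 - hp'.2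
        have : s - s' = 0 := (mul_eq_zero.1 e1).resolve_left (sub_ne_zero.2 hb)
        rw [h, sub_eq_zero.1 this]
    have : (S.card : ℝ) ≤ NS.card := by exact_mod_cast hle
    simp
    nlinarith
  · have haa : a - a' ≠ 0 := sub_ne_zero.2 ha
    obtain ⟨r', hr'⟩ : ∃ r', (a - a') * (r + r') = - (b - b') := ⟨-(b - b') / (a - a') - r, by field_simp; ring⟩
    have hv : ∀ s, (a * s ^ 2 + b * s + c) - (a' * s ^ 2 + b' * s + c') = (a - a') * ((s - r) * (s - r')) := by
      intro s
      linear_combination hr + s * hr' - r * hr'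
    have hmem : ∀ p ∈ S, p.2 = (p.1 - r) * (p.1 - r') ∧ ¬ IsSquare p.2 := by
      rintro ⟨s, n⟩ hp
      simp [hS, ev10, hNS] at hp
      refine ⟨?_, hp.1⟩
      have := hv s
      apply mul_left_cancel₀ haa
      simp only
      linear_combination this - hp.2
    by_cases hrr : r = r'
    · subst hrr
      have : S = ∅ := by
        apply Finset.eq_empty_of_forall_notMem
        intro p hp
        obtain ⟨h1, h2⟩ := hmem p hp
        exact h2 ⟨_, h1⟩
      rw [this]
      simp [ha]
      apply mul_nonneg hm0; linarith
    · have hk2 : 2 ≤ kk (a, b, c) (a', b', c') := by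
        have : ({r, r'} : Finset F) ⊆ Finset.univ.filter (fun x => ev10 (a, b, c) x = ev10 (a', b', c') x) := by
          intro x hx
          simp at hx
          refine Finset.mem_filter.2 ⟨Finset.mem_univ _, ?_⟩
          simp only [ev10]
          rw [← sub_eq_zero, hv]
          rcases hx with rfl | rfl <;> simp
        have h := Finset.card_le_card this
        rwa [Finset.card_pair hrr] at h
      have hk2' : (2 : ℝ) ≤ kk (a, b, c) (a', b', c') := by exact_mod_cast hk2
      have hle : S.card ≤ NS.card := by
        have hne : ∀ p ∈ S, p.1 - r' ≠ 0 := by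
          intro p hp h0
          obtain ⟨h1, h2⟩ := hmem p hp
          apply h2
          rw [h1, h0]; simp
        apply Finset.card_le_card_of_injOn (fun p => (p.1 - r) / (p.1 - r'))
        · intro p hp
          obtain ⟨h1, h2⟩ := hmem p hp
          have h0 := hne p hp
          simp only [hNS, Finset.coe_filter, Finset.mem_univ, true_and, Set.mem_ofPred_eq]
          rintro ⟨y, hy⟩
          apply h2
          refine ⟨y * (p.1 - r'), ?_⟩
          rw [div_eq_iff h0] at hy
          rw [h1, hy]; ring
        · intro p hp p' hp' h
          have h0 := hne p hp
          have h0' := hne p' hp'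
          have h1 := (hmem p hp).1
          have h1' := (hmem p' hp').1
          simp only at h
          rw [div_eq_div_iff h0 h0'] at h
          have e1 : (r - r') * (p.1 - p'.1) = 0 := by linear_combination h
          have : p.1 = p'.1 := sub_eq_zero.1 ((mul_eq_zero.1 e1).resolve_left (sub_ne_zero.2 hrr))
          ext
          · exact this
          · rw [h1, h1', this]
      have : (S.card : ℝ) ≤ NS.card := by exact_mod_cast hle
      simp [ha]
      nlinarith

/-- Cauchy-Schwarz for fibres. -/
lemma fibre_cs (U : Finset (F × F × F)) (L : F × F × F → F) :
    (U.card : ℝ) ^ 2 ≤ (Fintype.card F : ℝ) * ∑ f ∈ U, ∑ g ∈ U, if L f = L g then (1 : ℝ) else 0 := by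
  have h1 : ∑ f ∈ U, ∑ g ∈ U, (if L f = L g then (1 : ℝ) else 0)
      = ∑ y : F, (∑ f ∈ U, if L f = y then (1 : ℝ) else 0) ^ 2 := by
    simp_rw [pow_two, Finset.sum_mul_sum]
    rw [Finset.sum_comm]
    rw [Finset.sum_comm (s := Finset.univ), Finset.sum_comm]
    refine Finset.sum_congr rfl fun f _ => ?_
    rw [Finset.sum_comm]
    refine Finset.sum_congr rfl fun g _ => ?_
    simp
    try simp [eq_comm]
  have h2 : (U.card : ℝ) = ∑ y : F, (∑ f ∈ U, if L f = y then (1 : ℝ) else 0) := by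
    rw [Finset.sum_comm]; simp
  rw [h1, h2]
  have := sq_sum_le_card_mul_sum_sq (s := (Finset.univ : Finset F)) (f := fun y => ∑ f ∈ U, if L f = y then (1 : ℝ) else 0)
  simpa using this


open Classical in
lemma kbound (hodd : Odd (Fintype.card F)) (hq : 9 < Fintype.card F) (U : Finset (F × F × F))
    (hint : ∀ f ∈ U, ∀ g ∈ U, ∃ x : F, ev10 f x = ev10 g x) :
    2 * (U.card : ℝ) ^ 2 - (Fintype.card F : ℝ) * U.card ≤ ∑ f ∈ U, ∑ g ∈ U, (kk f g : ℝ) := by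
  set NS := Finset.univ.filter (fun z : F => ¬ IsSquare z) with hNS
  have hm := nonsq_card (F := F) hodd
  rw [← hNS] at hm
  have hmpos : (0 : ℝ) < NS.card := by
    have : 0 < NS.card := by omega
    exact_mod_cast this
  have hqpos : (0 : ℝ) < Fintype.card F := by
    have : 0 < Fintype.card F := by omega
    exact_mod_cast this
  -- Cauchy–Schwarz summed over all functionals
  have h1 : ∑ p ∈ (Finset.univ : Finset F) ×ˢ NS, (U.card : ℝ) ^ 2 ≤
      ∑ p ∈ (Finset.univ : Finset F) ×ˢ NS, (Fintype.card F : ℝ) * ∑ f ∈ U, ∑ g ∈ U,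
        if ev10 f p.1 - p.2 * f.1 = ev10 g p.1 - p.2 * g.1 then (1 : ℝ) else 0 :=
    Finset.sum_le_sum fun p _ => fibre_cs U (fun f => ev10 f p.1 - p.2 * f.1)
  rw [Finset.sum_const, Finset.card_product, Finset.card_univ, nsmul_eq_mul, ← Finset.mul_sum] at h1
  push_cast at h1
  rw [mul_assoc] at h1
  have h2 := le_of_mul_le_mul_left h1 hqpos
  have h3 : ∑ p ∈ (Finset.univ : Finset F) ×ˢ NS, ∑ f ∈ U, ∑ g ∈ U,
        (if ev10 f p.1 - p.2 * f.1 = ev10 g p.1 - p.2 * g.1 then (1 : ℝ) else 0)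
      ≤ ∑ f ∈ U, ∑ g ∈ U, (NS.card : ℝ) * ((kk f g : ℝ) - 1 + if f.1 = g.1 then 1 else 0) := by
    rw [Finset.sum_comm]
    refine Finset.sum_le_sum fun f hf => ?_
    rw [Finset.sum_comm]
    refine Finset.sum_le_sum fun g hg => ?_
    by_cases hfg : f = g
    · subst hfg
      simp [kk]
      rw [mul_comm]
    · have := ccount hodd f g hfg (hint f hf g hg)
      rw [← hNS] at this
      rw [← Finset.sum_filter, Finset.sum_const, nsmul_eq_mul, mul_one]
      exact this
  have h4 := h2.trans h3
  simp_rw [← Finset.mul_sum] at h4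
  have h5 := le_of_mul_le_mul_left h4 hmpos
  simp_rw [Finset.sum_add_distrib, Finset.sum_sub_distrib] at h5
  have h6 : ∑ f ∈ U, ∑ g ∈ U, (if f.1 = g.1 then (1 : ℝ) else 0)
      ≤ ∑ f ∈ U, (Fintype.card F : ℝ) := by
    refine Finset.sum_le_sum fun f hf => ?_
    rw [← Finset.sum_filter, Finset.sum_const, nsmul_eq_mul, mul_one]
    have : (U.filter (fun g => f.1 = g.1)).card ≤ (Finset.univ : Finset F).card := by
      apply Finset.card_le_card_of_injOn (fun g => g.2.1)
      · intro _ _; simp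
      · rintro ⟨a, b, c⟩ hg ⟨a', b', c'⟩ hg' h
        simp at hg hg' h
        obtain ⟨x, hx⟩ := hint _ hg.1 _ hg'.1
        have ha : a = a' := hg.2.symm.trans hg'.2
        subst ha
        subst h
        simp [ev10] at hx
        rw [hx]
    rw [Finset.card_univ] at this
    exact_mod_cast this
  simp at h5 h6
  nlinarith

open Classical in
lemma threshold (hodd : Odd (Fintype.card F)) (U : Finset (F × F × F))
    (hint : ∀ f ∈ U, ∀ g ∈ U, ∃ x : F, ev10 f x = ev10 g x) (α β : F)
    (f : F × F × F) (hf : f ∈ U) (hne : ev10 f α ≠ β) :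
    (((U.filter (fun g => ev10 g α = β)).card : ℝ)) ≤
      (Fintype.card F : ℝ) * ((Fintype.card F : ℝ) + 1) / 2 := by
  have hm := nonsq_card (F := F) hodd
  have hs : (Finset.univ.filter (fun z : F => IsSquare z)).card +
      (Finset.univ.filter (fun z : F => ¬ IsSquare z)).card = Fintype.card F := by
    rw [Finset.card_filter_add_card_filter_not, Finset.card_univ]
  have h2 : (2 : F) ≠ 0 := by
    apply Ring.two_ne_zero
    intro h
    have := FiniteField.even_card_of_char_two h
    rw [Nat.odd_iff] at hodd; omega
  have key : (U.filter (fun g => ev10 g α = β)).card ≤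
      ((Finset.univ : Finset F) ×ˢ (Finset.univ.filter (fun z : F => IsSquare z))).card := by
    obtain ⟨a, b, c⟩ := f
    simp only [ev10] at hne
    apply Finset.card_le_card_of_injOn
      (fun g => (2 * (g.1 - a) * α + (g.2.1 - b), (g.2.1 - b) ^ 2 - 4 * (g.1 - a) * (g.2.2 - c)))
    · rintro ⟨a', b', c'⟩ hg
      have hg := (Finset.mem_filter.1 (Finset.mem_coe.1 hg)).1
      obtain ⟨x, hx⟩ := hint _ hf _ hg
      simp only [ev10] at hx
      simp only [Finset.coe_product, Finset.coe_univ, Set.mem_prod, Set.mem_univ, true_and, Finset.mem_coe, Finset.mem_filter, Finset.mem_univ]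
      refine ⟨2 * (a' - a) * x + (b' - b), ?_⟩
      linear_combination 4 * (a' - a) * hx
    · rintro ⟨a1, b1, c1⟩ hg ⟨a2, b2, c2⟩ hg' h
      have hg := (Finset.mem_filter.1 (Finset.mem_coe.1 hg)).2
      have hg' := (Finset.mem_filter.1 (Finset.mem_coe.1 hg')).2
      simp only [ev10] at hg hg'
      simp only [Prod.mk.injEq] at h
      obtain ⟨e1, e2⟩ := h
      set γ := β - (a * α ^ 2 + b * α + c) with hγ
      have hγ0 : γ ≠ 0 := sub_ne_zero.2 (Ne.symm hne)
      have e3 : (2 * 2 * γ) * (a1 - a2) = 0 := by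
        have i1 : (b1 - b) ^ 2 - 4 * (a1 - a) * (c1 - c) = (2 * (a1 - a) * α + (b1 - b)) ^ 2 - 4 * (a1 - a) * γ := by
          rw [hγ, ← hg]; ring
        have i2 : (b2 - b) ^ 2 - 4 * (a2 - a) * (c2 - c) = (2 * (a2 - a) * α + (b2 - b)) ^ 2 - 4 * (a2 - a) * γ := by
          rw [hγ, ← hg']; ring
        rw [i1, i2, e1] at e2
        linear_combination -e2
      have ea : a1 = a2 := sub_eq_zero.1
        ((mul_eq_zero.1 e3).resolve_left (mul_ne_zero (mul_ne_zero h2 h2) hγ0))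
      subst ea
      have eb : b1 = b2 := by linear_combination e1
      subst eb
      have ec : c1 = c2 := by linear_combination hg - hg'
      rw [ec]
  rw [Finset.card_product, Finset.card_univ] at key
  have k2 : 2 * (U.filter (fun g => ev10 g α = β)).card ≤ Fintype.card F * (Fintype.card F + 1) := by
    have : 2 * (Finset.univ.filter (fun z : F => IsSquare z)).card = Fintype.card F + 1 := by omega
    rw [← this]; nlinarith
  have k3 : 2 * ((U.filter (fun g => ev10 g α = β)).card : ℝ) ≤ Fintype.card F * (Fintype.card F + 1) := by
    exact_mod_cast k2
  linarith

lemma numeric (q s u ε t : ℝ) (hs : s ^ 2 = q) (hs3 : 10 < q) (hs0 : 0 ≤ s) (hu : u = q ^ 2 - ε) (hε0 : 0 ≤ ε)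
    (hε : ε < q * s / 4 - 3 * q / 8 - s / 8) (ht : u - q ≤ t)
    (h : t * (t + u) ≤ (q * (q + 1) / 2 - u / q + u) * q ^ 2) : False := by
  have hs3' : 3 < s := by nlinarith
  have hq0 : 0 < q := by linarith
  have hεq : ε < q ^ 2 / 4 := by nlinarith
  have hup : 0 < u - q := by nlinarith
  have h1 : (u - q) * (u - q + u) ≤ t * (t + u) := by nlinarith
  have h2 : (q * (q + 1) / 2 - u / q + u) * q ^ 2 = (q * (q + 1) / 2 + u) * q ^ 2 - u * q := by
    field_simp
    ring
  rw [h2] at h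
  have h3 := h1.trans h
  subst hu
  have h4 : 6 * ε < q ^ 2 - 5 * q + 2 := by
    have : 6 * (q * s / 4 - 3 * q / 8 - s / 8) < q ^ 2 - 5 * q + 2 := by
      subst hs
      have : 3.16 < s := by nlinarith
      nlinarith [mul_pos (show (0:ℝ) < s ^ 2 by positivity) (show 0 < s - 3.16 by linarith), mul_pos (mul_pos (show (0:ℝ) < s ^ 2 by positivity) (show 0 < s - 3.16 by linarith)) (show 0 < s - 3 by linarith)]
    linarith
  have h5 := mul_lt_mul_of_pos_right h4 (show 0 < q ^ 2 by positivity)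
  nlinarith [mul_nonneg hε0 hq0.le, sq_nonneg ε]

lemma core (hodd : Odd (Fintype.card F)) (hq : 9 < Fintype.card F) (U : Finset (F × F × F))
    (hint : ∀ f ∈ U, ∀ g ∈ U, ∃ x : F, ev10 f x = ev10 g x)
    (ε : ℕ) (hcard : U.card + ε = Fintype.card F ^ 2)
    (hε : (ε : ℝ) < (Fintype.card F : ℝ) * Real.sqrt (Fintype.card F) / 4
      - 3 * (Fintype.card F : ℝ) / 8 - Real.sqrt (Fintype.card F) / 8) :
    ∃ α β : F, ∀ f ∈ U, ev10 f α = β := by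
  classical
  by_contra hcon
  push Not at hcon
  set q : ℝ := (Fintype.card F : ℝ) with hqdef
  set u : ℝ := (U.card : ℝ) with hudef
  have hq10 : (10 : ℝ) ≤ q := by
    have : 10 ≤ Fintype.card F := hq
    rw [hqdef]; exact_mod_cast this
  have hq10' : (10 : ℝ) < q := by
    have : 10 < Fintype.card F := by
      rcases Nat.lt_or_ge 10 (Fintype.card F) with h | h
      · exact h
      · rw [Nat.odd_iff] at hodd; omega
    rw [hqdef]; exact_mod_cast this
  have hq0 : (0 : ℝ) < q := by linarith
  have hu : u = q ^ 2 - ε := by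
    have : u + ε = q ^ 2 := by rw [hudef, hqdef]; exact_mod_cast hcard
    linarith
  set s := Real.sqrt q with hsdef
  have hs2 : s ^ 2 = q := Real.sq_sqrt hq0.le
  have hs0 : 0 ≤ s := Real.sqrt_nonneg _
  have huq : q < u := by
    have : 3 < s := by nlinarith
    have : (ε : ℝ) < q ^ 2 / 4 := by nlinarith
    nlinarith
  have hu0 : 0 < u := by linarith
  let N : F → F → ℝ := fun x y => ∑ g ∈ U, if ev10 g x = y then (1 : ℝ) else 0
  let D : F → F → ℝ := fun x y => N x y - u / q
  have hNsum : ∀ x, ∑ y, N x y = u := by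
    intro x
    simp only [N]
    rw [Finset.sum_comm]
    simp [hudef]
  have hDsum : ∀ x, ∑ y, D x y = 0 := by
    intro x
    simp only [D]
    rw [Finset.sum_sub_distrib, hNsum]
    simp [← hqdef]
    field_simp
    ring
  have hNle : ∀ x y, N x y ≤ q * (q + 1) / 2 := by
    intro x y
    obtain ⟨f, hf, hne⟩ := hcon x y
    have := threshold hodd U hint x y f hf hne
    simpa [N] using this
  have hN0 : ∀ x y, 0 ≤ N x y := by
    intro x y
    apply Finset.sum_nonneg; intro g _; split_ifs <;> simp
  let T : F × F × F → ℝ := fun v => ∑ x, D x (ev10 v x)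
  have hTS : ∀ v, T v = ∑ x, N x (ev10 v x) - u := by
    intro v
    simp only [T, D]
    rw [Finset.sum_sub_distrib]
    simp [← hqdef]
    field_simp
  have hSk : ∀ v, ∑ x, N x (ev10 v x) = ∑ g ∈ U, (kk v g : ℝ) := by
    intro v
    simp only [N]
    rw [Finset.sum_comm]
    refine Finset.sum_congr rfl fun g _ => ?_
    simp [kk, eq_comm]
  have hTlow : ∀ v, -u ≤ T v := by
    intro v
    rw [hTS]
    have : 0 ≤ ∑ x, N x (ev10 v x) := Finset.sum_nonneg fun x _ => hN0 _ _
    linarith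
  have hTU : ∀ v ∈ U, 0 ≤ T v := by
    intro v hv
    rw [hTS, hSk]
    have : ∑ g ∈ U, (1 : ℝ) ≤ ∑ g ∈ U, (kk v g : ℝ) := by
      refine Finset.sum_le_sum fun g hg => ?_
      obtain ⟨x, hx⟩ := hint v hv g hg
      have : 1 ≤ kk v g := Finset.card_pos.2 ⟨x, by simp [hx]⟩
      exact_mod_cast this
    simp at this
    linarith
  set A : ℝ := ∑ x, ∑ y, D x y ^ 2 with hA
  have hA1 : ∑ v ∈ U, T v = A := by
    simp only [T]
    rw [Finset.sum_comm, hA]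
    refine Finset.sum_congr rfl fun x _ => ?_
    have e1 : ∑ v ∈ U, D x (ev10 v x) = ∑ y, N x y * D x y := by
      simp only [N, Finset.sum_mul]
      rw [Finset.sum_comm]
      refine Finset.sum_congr rfl fun v _ => ?_
      simp
    have e2 : ∑ y, N x y * D x y = ∑ y, (D x y ^ 2 + u / q * D x y) := by
      refine Finset.sum_congr rfl fun y _ => ?_
      simp only [D]; ring
    rw [e1, e2, Finset.sum_add_distrib, ← Finset.mul_sum, hDsum]
    ring
  have hA2 : ∑ v, T v ^ 2 = q ^ 2 * A := mom2 D hDsum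
  have hA3 : ∑ v, T v ^ 3 = q ^ 2 * ∑ x, ∑ y, D x y ^ 3 := mom3 D hDsum
  set M : ℝ := q * (q + 1) / 2 - u / q with hM
  have hDM : ∑ x, ∑ y, D x y ^ 3 ≤ M * A := by
    rw [hA, Finset.mul_sum]
    refine Finset.sum_le_sum fun x _ => ?_
    rw [Finset.mul_sum]
    refine Finset.sum_le_sum fun y _ => ?_
    have : D x y ≤ M := by
      simp only [D, hM]; linarith [hNle x y]
    nlinarith [mul_nonneg (sq_nonneg (D x y)) (sub_nonneg.2 this)]
  have hAlow : u * (u - q) ≤ A := by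
    rw [← hA1]
    simp_rw [hTS, hSk]
    rw [Finset.sum_sub_distrib]
    have := kbound hodd hq U hint
    simp [← hudef]
    rw [← hqdef, ← hudef] at this
    nlinarith
  set t : ℝ := A / u with ht
  have hAt : A = u * t := by rw [ht]; field_simp
  have htlow : u - q ≤ t := by
    rw [ht, le_div_iff₀ hu0]; linarith
  have htpos : 0 < t := by linarith
  -- main inequality
  have m1 : ∑ v ∈ U, T v ^ 2 * (T v + u) ≤ ∑ v, T v ^ 2 * (T v + u) := by
    refine Finset.sum_le_sum_of_subset_of_nonneg (Finset.subset_univ _) fun v _ _ => ?_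
    exact mul_nonneg (sq_nonneg _) (by linarith [hTlow v])
  have m2 : ∑ v, T v ^ 2 * (T v + u) = ∑ v, T v ^ 3 + u * ∑ v, T v ^ 2 := by
    rw [Finset.mul_sum, ← Finset.sum_add_distrib]
    refine Finset.sum_congr rfl fun v _ => ?_
    ring
  have m3 : ∑ v ∈ U, ((3 * t ^ 2 + 2 * u * t) * T v - (2 * t ^ 3 + u * t ^ 2)) ≤
      ∑ v ∈ U, T v ^ 2 * (T v + u) := by
    refine Finset.sum_le_sum fun v hv => ?_
    have h0 := hTU v hv
    nlinarith [mul_nonneg (sq_nonneg (T v - t)) (show 0 ≤ T v + 2 * t + u by linarith)]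
  rw [Finset.sum_sub_distrib, ← Finset.mul_sum, hA1, Finset.sum_const, nsmul_eq_mul, ← hudef, hAt] at m3
  have m4 : (u * t) * (t * (t + u)) ≤ (u * t) * ((M + u) * q ^ 2) := by
    have hD3 : q ^ 2 * ∑ x, ∑ y, D x y ^ 3 ≤ q ^ 2 * (M * A) :=
      mul_le_mul_of_nonneg_left hDM (by positivity)
    rw [m2, hA3, hA2] at m1
    rw [hAt] at hD3 m1
    nlinarith
  have m5 := le_of_mul_le_mul_left m4 (mul_pos hu0 htpos)
  exact numeric q s u ε t hs2 hq10' hs0 hu (by positivity) hε htlow m5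

end helpers

/-- If `q > 9` is odd and `U` is an intersecting family of polynomials over `F_q` of degree
at most `2` with `|U| = q^2 − ε` where `ε < q√q/4 − 3q/8 − √q/8`, then the graphs of the
polynomials in `U` share a common point. -/
theorem stmt10 (F : Type*) [Field F] [Fintype F]
    (hodd : Odd (Fintype.card F)) (hq : 9 < Fintype.card F)
    (U : Finset (Polynomial F)) (hdeg : ∀ f ∈ U, f.natDegree ≤ 2)
    (hint : ∀ f ∈ U, ∀ g ∈ U, ∃ x : F, f.eval x = g.eval x)
    (ε : ℕ) (hcard : U.card + ε = Fintype.card F ^ 2)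
    (hε : (ε : ℝ) < (Fintype.card F : ℝ) * Real.sqrt (Fintype.card F) / 4
      - 3 * (Fintype.card F : ℝ) / 8 - Real.sqrt (Fintype.card F) / 8) :
    ∃ α β : F, ∀ f ∈ U, f.eval α = β := by
  classical
  let φ : Polynomial F → F × F × F := fun f => (f.coeff 2, f.coeff 1, f.coeff 0)
  have hφ : ∀ f ∈ U, ∀ x, ev10 (φ f) x = f.eval x := by
    intro f hf x
    rw [Polynomial.eval_eq_sum_range' (n := 3) (by have := hdeg f hf; omega)]
    simp [Finset.sum_range_succ, ev10, φ]
    ring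
  have hinj : Set.InjOn φ U := by
    intro f hf g hg h
    simp only [φ, Prod.mk.injEq] at h
    ext n
    rcases n with _ | _ | _ | n
    · exact h.2.2
    · exact h.2.1
    · exact h.1
    · rw [Polynomial.coeff_eq_zero_of_natDegree_lt, Polynomial.coeff_eq_zero_of_natDegree_lt]
      · have := hdeg g hg; omega
      · have := hdeg f hf; omega
  have hc : (U.image φ).card = U.card := Finset.card_image_of_injOn hinj
  obtain ⟨α, β, h⟩ := core hodd hq (U.image φ) (by
    intro f' hf' g' hg'
    obtain ⟨f, hf, rfl⟩ := Finset.mem_image.1 hf'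
    obtain ⟨g, hg, rfl⟩ := Finset.mem_image.1 hg'
    obtain ⟨x, hx⟩ := hint f hf g hg
    exact ⟨x, by rw [hφ f hf, hφ g hg, hx]⟩) ε (by rw [hc, hcard]) hε
  exact ⟨α, β, fun f hf => by rw [← hφ f hf]; exact h _ (Finset.mem_image_of_mem _ hf)⟩
end

section
/- Let q be a prime power with q > 9 if q is odd and q > 2 if q is even, let k > 1, and let U be an intersecting family of polynomials over F_q of degree at most k with |U| > q^k − q^{k−1}. Then there exist α, β ∈ F_q such that g(α) = β for every g ∈ U. -/
open Polynomial

namespace IFam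
/-- number of solutions y -/
def rr {F : Type*} [Field F] [Fintype F] [DecidableEq F] (δ : F) (p s : F × F) : ℤ :=
  ∑ y : F, if s.2 = δ * y ^ 2 + (p.1 - s.1) * y + p.2 then 1 else 0

section mix
variable {F : Type*} [Field F] [Fintype F] [DecidableEq F]

lemma rr_sum_right (δ : F) (p : F × F) :
    ∑ s : F × F, rr δ p s = (Fintype.card F : ℤ) ^ 2 := by
  unfold rr
  rw [Finset.sum_comm]
  simp_rw [Fintype.sum_prod_type]
  simp [sq]

lemma rr_sum_left (δ : F) (s : F × F) :
    ∑ p : F × F, rr δ p s = (Fintype.card F : ℤ) ^ 2 := by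
  unfold rr
  rw [Finset.sum_comm]
  simp_rw [Fintype.sum_prod_type]
  have : ∀ y x : F, ∑ z : F, (if s.2 = δ * y ^ 2 + (x - s.1) * y + z then (1:ℤ) else 0) = 1 := by
    intro y x
    rw [Finset.sum_eq_single (s.2 - (δ * y ^ 2 + (x - s.1) * y))]
    · simp
    · intro b _ hb
      rw [if_neg]
      intro h
      apply hb
      rw [h]; ring
    · simp
  simp only [this]
  simp [sq]

lemma rr_inner_ne (δ : F) (p t : F × F) (y z : F) (hyz : y ≠ z) :
    ∑ s : F × F, ((if s.2 = δ * y ^ 2 + (p.1 - s.1) * y + p.2 then (1:ℤ) else 0) *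
      (if s.2 = δ * z ^ 2 + (t.1 - s.1) * z + t.2 then 1 else 0)) = 1 := by
  have h0 : y - z ≠ 0 := sub_ne_zero.mpr hyz
  set u : F := (δ * y ^ 2 + p.1 * y + p.2 - (δ * z ^ 2 + t.1 * z + t.2)) / (y - z) with hu
  have hu' : u * (y - z) = δ * y ^ 2 + p.1 * y + p.2 - (δ * z ^ 2 + t.1 * z + t.2) := by
    rw [hu]; field_simp
  rw [Finset.sum_eq_single (u, δ * y ^ 2 + (p.1 - u) * y + p.2)]
  · simp only [if_true, one_mul]
    rw [if_pos]
    linear_combination -hu'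
  · rintro ⟨a, b⟩ _ hne
    simp only
    by_cases h1 : b = δ * y ^ 2 + (p.1 - a) * y + p.2
    · by_cases h2 : b = δ * z ^ 2 + (t.1 - a) * z + t.2
      · exfalso
        apply hne
        have : a = u := by
          apply mul_right_cancel₀ h0
          rw [hu']
          linear_combination h1 - h2
        rw [← this, ← h1]
      · simp [h2]
    · simp [h1]
  · simp

lemma rr_inner_eq (δ : F) (p t : F × F) (y : F) :
    ∑ s : F × F, ((if s.2 = δ * y ^ 2 + (p.1 - s.1) * y + p.2 then (1:ℤ) else 0) *
      (if s.2 = δ * y ^ 2 + (t.1 - s.1) * y + t.2 then 1 else 0)) =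
      if p.1 * y + p.2 = t.1 * y + t.2 then (Fintype.card F : ℤ) else 0 := by
  rw [Fintype.sum_prod_type]
  split_ifs with h
  · have : ∀ a b : F, ((if b = δ * y ^ 2 + (p.1 - a) * y + p.2 then (1:ℤ) else 0) *
      (if b = δ * y ^ 2 + (t.1 - a) * y + t.2 then 1 else 0)) =
        if b = δ * y ^ 2 + (p.1 - a) * y + p.2 then (1:ℤ) else 0 := by
      intro a b
      have e : δ * y ^ 2 + (t.1 - a) * y + t.2 = δ * y ^ 2 + (p.1 - a) * y + p.2 := by
        linear_combination -h
      rw [e]; split_ifs <;> simp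
    simp [this]
  · apply Finset.sum_eq_zero; intro a _
    apply Finset.sum_eq_zero; intro b _
    simp only
    by_cases h1 : b = δ * y ^ 2 + (p.1 - a) * y + p.2
    · rw [if_neg (c := b = δ * y ^ 2 + (t.1 - a) * y + t.2)]
      · simp
      · intro h2; apply h; linear_combination h2 - h1
    · simp [h1]

lemma rr_mul_sum (δ : F) (p t : F × F) :
    ∑ s : F × F, rr δ p s * rr δ t s = (Fintype.card F : ℤ) * (Fintype.card F - 1) +
      ∑ y : F, if p.1 * y + p.2 = t.1 * y + t.2 then (Fintype.card F : ℤ) else 0 := by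
  unfold rr
  simp_rw [Finset.sum_mul_sum]
  rw [Finset.sum_comm]
  have : ∀ y : F, ∑ s : F × F, ∑ z : F, ((if s.2 = δ * y ^ 2 + (p.1 - s.1) * y + p.2 then (1:ℤ) else 0) *
      (if s.2 = δ * z ^ 2 + (t.1 - s.1) * z + t.2 then 1 else 0)) = (Fintype.card F - 1) +
      if p.1 * y + p.2 = t.1 * y + t.2 then (Fintype.card F : ℤ) else 0 := by
    intro y
    rw [Finset.sum_comm, ← Finset.add_sum_erase _ _ (Finset.mem_univ y), rr_inner_eq, add_comm]
    congr 1
    rw [Finset.sum_congr rfl (g := fun _ => (1:ℤ))]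
    · simp [Finset.card_erase_of_mem, Finset.card_univ, Nat.cast_sub Fintype.card_pos]
    · intro z hz
      exact rr_inner_ne δ p t y z (Finset.ne_of_mem_erase hz).symm
  rw [Finset.sum_congr rfl (fun y _ => this y), Finset.sum_add_distrib]
  simp [mul_sub]

lemma rr_mul_sum_ne (δ : F) (p t : F × F) (h : p ≠ t) :
    ∑ s : F × F, rr δ p s * rr δ t s ≤ (Fintype.card F : ℤ) * (Fintype.card F - 1) +
      Fintype.card F := by
  rw [rr_mul_sum, ← Finset.sum_filter, Finset.sum_const, nsmul_eq_mul]
  have : (Finset.univ.filter fun y : F => p.1 * y + p.2 = t.1 * y + t.2).card ≤ 1 := by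
    rw [Finset.card_le_one]
    intro a ha b hb
    simp only [Finset.mem_filter, Finset.mem_univ, true_and] at ha hb
    by_contra hab
    have h1 : p.1 = t.1 := by
      have : (p.1 - t.1) * (a - b) = 0 := by linear_combination ha - hb
      rcases mul_eq_zero.mp this with h | h
      · exact sub_eq_zero.mp h
      · exact absurd (sub_eq_zero.mp h) hab
    apply h
    apply Prod.ext h1
    rw [h1] at ha
    exact add_left_cancel ha
  have h2 : ((Finset.univ.filter fun y : F => p.1 * y + p.2 = t.1 * y + t.2).card : ℤ) ≤ 1 := by
    exact_mod_cast this
  nlinarith [Int.natCast_nonneg (Fintype.card F)]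

lemma rr_mul_sum_self (δ : F) (p : F × F) :
    ∑ s : F × F, rr δ p s * rr δ p s = (Fintype.card F : ℤ) * (Fintype.card F - 1) +
      Fintype.card F * Fintype.card F := by
  rw [rr_mul_sum]; simp

lemma mix_upper (δ : F) (A : Finset (F × F)) :
    ∑ s : F × F, (∑ p ∈ A, (rr δ p s - 1)) ^ 2 ≤
      (A.card : ℤ) * ((Fintype.card F : ℤ) ^ 2 - Fintype.card F) := by
  have h : ∀ p t, ∑ s : F × F, (rr δ p s - 1) * (rr δ t s - 1) ≤
      if p = t then (Fintype.card F : ℤ) ^ 2 - Fintype.card F else 0 := by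
    intro p t
    have e : ∑ s : F × F, (rr δ p s - 1) * (rr δ t s - 1) =
        ∑ s : F × F, rr δ p s * rr δ t s - ∑ s : F × F, rr δ p s - ∑ s : F × F, rr δ t s
          + (Fintype.card F : ℤ) ^ 2 := by
      have : ∀ s, (rr δ p s - 1) * (rr δ t s - 1) =
        rr δ p s * rr δ t s - rr δ p s - rr δ t s + 1 := by intro s; ring
      simp_rw [this, Finset.sum_add_distrib, Finset.sum_sub_distrib]
      simp [sq]
    rw [e, rr_sum_right, rr_sum_right]
    split_ifs with hpt
    · subst hpt
      rw [rr_mul_sum_self]; nlinarith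
    · have := rr_mul_sum_ne δ p t hpt
      nlinarith
  simp_rw [sq (∑ p ∈ A, _), Finset.sum_mul_sum]
  rw [Finset.sum_comm]
  calc ∑ p ∈ A, ∑ s : F × F, ∑ t ∈ A, (rr δ p s - 1) * (rr δ t s - 1)
      = ∑ p ∈ A, ∑ t ∈ A, ∑ s : F × F, (rr δ p s - 1) * (rr δ t s - 1) := by
        apply Finset.sum_congr rfl; intro p _; rw [Finset.sum_comm]
    _ ≤ ∑ p ∈ A, ∑ t ∈ A, if p = t then (Fintype.card F : ℤ) ^ 2 - Fintype.card F else 0 := by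
        apply Finset.sum_le_sum; intro p _; apply Finset.sum_le_sum; intro t _; exact h p t
    _ = _ := by
        simp [mul_sub]

lemma rr_eq_card (δ : F) (p s : F × F) : rr δ p s =
    ((Finset.univ.filter fun y : F => s.2 = δ * y ^ 2 + (p.1 - s.1) * y + p.2).card : ℤ) := by
  unfold rr; simp

lemma mix_lower (δ : F) (hδ : δ ≠ 0) (A : Finset (F × F)) (s : F × F)
    (hA : ∀ p ∈ A, ∃ y : F, y ≠ 0 ∧ s.2 = δ * y ^ 2 + (p.1 - s.1) * y + p.2) :
    2 * (A.card : ℤ) - (Fintype.card F - 1) ≤ ∑ p ∈ A, rr δ p s := by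
  classical
  choose! f hf using hA
  set T := A.filter fun p => rr δ p s < 2 with hT
  have key : ∀ p ∈ T, p.1 = s.1 - 2 * δ * f p ∧ p.2 = s.2 - δ * (f p) ^ 2 - (p.1 - s.1) * f p := by
    intro p hp
    rw [hT, Finset.mem_filter] at hp
    obtain ⟨hpA, hlt⟩ := hp
    obtain ⟨h0, h1⟩ := hf p hpA
    rw [rr_eq_card] at hlt
    have hlt' : (Finset.univ.filter fun y : F => s.2 = δ * y ^ 2 + (p.1 - s.1) * y + p.2).card ≤ 1 := by
      have : (Finset.univ.filter fun y : F => s.2 = δ * y ^ 2 + (p.1 - s.1) * y + p.2).card < 2 := by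
        exact_mod_cast hlt
      omega
    rw [Finset.card_le_one] at hlt'
    have h2 : f p = -(p.1 - s.1) / δ - f p := by
      apply hlt'
      · simpa using h1
      · simp only [Finset.mem_filter, Finset.mem_univ, true_and]
        rw [h1]; field_simp; ring
    constructor
    · have : 2 * f p * δ = -(p.1 - s.1) := by
        have : 2 * f p = -(p.1 - s.1) / δ := by linear_combination h2
        rw [this]; field_simp
      linear_combination this
    · linear_combination -h1
  have hTc : T.card ≤ Fintype.card F - 1 := by
    have : T.card ≤ (Finset.univ.erase (0:F)).card := by
      apply Finset.card_le_card_of_injOn f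
      · intro p hp
        have : p ∈ A := (Finset.mem_filter.mp hp).1
        simp [(hf p this).1]
      · intro p hp t ht hpt
        obtain ⟨a1, a2⟩ := key p hp
        obtain ⟨b1, b2⟩ := key t ht
        have h1 : p.1 = t.1 := by rw [a1, b1, hpt]
        exact Prod.ext h1 (by rw [a2, b2, hpt, h1])
    simpa [Finset.card_erase_of_mem, Finset.card_univ] using this
  have hsum : ∑ p ∈ A, (2 - if rr δ p s < 2 then (1:ℤ) else 0) ≤ ∑ p ∈ A, rr δ p s := by
    apply Finset.sum_le_sum
    intro p hp
    have : 1 ≤ rr δ p s := by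
      rw [rr_eq_card]
      have : 0 < (Finset.univ.filter fun y : F => s.2 = δ * y ^ 2 + (p.1 - s.1) * y + p.2).card :=
        Finset.card_pos.mpr ⟨f p, by simpa using (hf p hp).2⟩
      exact_mod_cast this
    split_ifs <;> omega
  rw [Finset.sum_sub_distrib, ← Finset.sum_filter] at hsum
  simp only [Finset.sum_const, nsmul_eq_mul, mul_one] at hsum
  have hpos : 0 < Fintype.card F := Fintype.card_pos
  have : (T.card : ℤ) ≤ Fintype.card F - 1 := by omega
  rw [hT] at this
  linarith

lemma rr_nonneg (δ : F) (p s : F × F) : 0 ≤ rr δ p s := by rw [rr_eq_card]; positivity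

lemma mix_first (δ : F) (hδ : δ ≠ 0) (A : Finset (F × F)) (s : F × F)
    (hA : ∀ p ∈ A, ∃ y : F, y ≠ 0 ∧ s.2 = δ * y ^ 2 + (p.1 - s.1) * y + p.2) :
    2 * (A.card : ℤ) ≤ (Fintype.card F : ℤ) ^ 2 + Fintype.card F - 1 := by
  have h1 := mix_lower δ hδ A s hA
  have h2 : ∑ p ∈ A, rr δ p s ≤ ∑ p, rr δ p s :=
    Finset.sum_le_univ_sum_of_nonneg (fun p => rr_nonneg δ p s)
  rw [rr_sum_left] at h2
  linarith

lemma mix (δ : F) (hδ : δ ≠ 0) (A B : Finset (F × F))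
    (hA : ∀ s ∈ B, ∀ p ∈ A, ∃ y : F, y ≠ 0 ∧ s.2 = δ * y ^ 2 + (p.1 - s.1) * y + p.2)
    (hc : Fintype.card F - 1 ≤ A.card) :
    (B.card : ℤ) * ((A.card : ℤ) - (Fintype.card F - 1)) ^ 2 ≤
      (A.card : ℤ) * ((Fintype.card F : ℤ) ^ 2 - Fintype.card F) := by
  refine le_trans ?_ (mix_upper δ A)
  calc (B.card : ℤ) * ((A.card : ℤ) - (Fintype.card F - 1)) ^ 2
      = ∑ s ∈ B, ((A.card : ℤ) - (Fintype.card F - 1)) ^ 2 := by simp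
    _ ≤ ∑ s ∈ B, (∑ p ∈ A, (rr δ p s - 1)) ^ 2 := by
        apply Finset.sum_le_sum
        intro s hs
        have h := mix_lower δ hδ A s (hA s hs)
        apply pow_le_pow_left₀
        · have hpos : 0 < Fintype.card F := Fintype.card_pos
          omega
        · rw [Finset.sum_sub_distrib]
          simp only [Finset.sum_const, nsmul_eq_mul, mul_one]
          linarith
    _ ≤ _ := Finset.sum_le_univ_sum_of_nonneg (fun s => sq_nonneg _)
end mix

section redei
variable {F : Type*} [Field F] [Fintype F] [DecidableEq F]

lemma sum_rootMult_le (P : F[X]) (hP : P ≠ 0) : ∑ b : F, P.rootMultiplicity b ≤ P.natDegree := by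
  refine le_trans ?_ (Polynomial.card_roots' P)
  rw [← Multiset.sum_count_eq_card (s := Finset.univ) (fun a _ => Finset.mem_univ a)]
  simp

lemma sum_rootMult_deriv (P : F[X]) (hP : derivative P ≠ 0) :
    ∑ b : F, (P.rootMultiplicity b - 1) ≤ (derivative P).natDegree := by
  refine le_trans (Finset.sum_le_sum fun b _ => ?_) (sum_rootMult_le _ hP)
  exact rootMultiplicity_sub_one_le_derivative_rootMultiplicity_of_ne_zero _ _ hP

lemma sum_sub_one (m : F → ℕ) : ∑ b, m b ≤ ∑ b, (m b - 1) + (Finset.univ.filter fun b => 0 < m b).card := by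
  rw [Finset.card_filter, ← Finset.sum_add_distrib]
  apply Finset.sum_le_sum
  intro b _
  split_ifs <;> omega

lemma pth_root (p : ℕ) [Fact p.Prime] [CharP F p] (g : F[X]) (hg : derivative g = 0) :
    ∃ r : F[X], g = r ^ p := by
  have h := expand_contract p hg (Fact.out : p.Prime).ne_zero
  refine ⟨map (frobeniusEquiv F p).symm.toRingHom (contract p g), ?_⟩
  rw [← map_frobenius_expand p, ← map_expand, h, map_map]
  conv_lhs => rw [← map_id (p := g)]
  congr 1
  ext x
  simp

lemma mult_pow (t : F[X]) (ht : t ≠ 0) (b : F) (n N : ℕ) (h : (X - C b) ^ N ∣ t ^ n) :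
    N ≤ n * t.rootMultiplicity b := by
  have h1 := (le_rootMultiplicity_iff (pow_ne_zero n ht)).mpr h
  rw [← count_roots, roots_pow, Multiset.count_nsmul, count_roots] at h1
  exact h1

lemma X_pow_sub_ne (n : ℕ) (g : F[X]) (h : g.natDegree < n) :
    (X ^ n - g).natDegree = n ∧ X ^ n - g ≠ 0 := by
  have h1 : (X ^ n - g).natDegree = n := by
    rw [natDegree_sub_eq_left_of_natDegree_lt] <;> simp [h]
  refine ⟨h1, ?_⟩
  rintro h0
  rw [h0] at h1
  simp at h1
  omega

lemma redei_step (p h e : ℕ) [Fact p.Prime] [CharP F p] (hq : Fintype.card F = p ^ h)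
    (hq4 : 4 ≤ p ^ h) (hodd : p ≠ 2 → 9 < p ^ h) (he : e < h) (D M : ℕ) (hD : 2 * D + 2 = (p ^ h) ^ 2 + p ^ h)
    (hM : (p ^ h) ^ 2 - p ^ h < M) (N : F → ℕ) (hN : ∑ b, N b = M) (g : F[X])
    (hg : p ^ e * g.natDegree ≤ D)
    (hdvd : ∀ b, (X - C b) ^ N b ∣ (X ^ (p ^ (2 * h - e)) - g) ^ (p ^ e)) :
    derivative g = 0 := by
  by_contra hne
  have hp : p.Prime := Fact.out
  have hpe : 0 < p ^ e := pow_pos hp.pos _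
  set n := p ^ (2 * h - e) with hn
  have hnn : p ^ e * n = (p ^ h) ^ 2 := by
    rw [hn, ← pow_add, ← pow_mul]; congr 1; omega
  have hgn : g.natDegree < n := by
    by_contra hle
    push Not at hle
    have := Nat.mul_le_mul_left (p ^ e) hle
    nlinarith
  obtain ⟨htd, ht0⟩ := X_pow_sub_ne n g hgn
  set t := X ^ n - g with ht
  have hpn : (n : F[X]) = 0 := by
    rw [hn]
    have : 2 * h - e ≠ 0 := by omega
    push_cast
    rw [CharP.cast_eq_zero, zero_pow this]
  have hdt : derivative t = - derivative g := by
    rw [ht]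
    simp [derivative_X_pow, hpn]
  have hd0 : derivative t ≠ 0 := by rw [hdt]; simpa using hne
  have h1 := sum_rootMult_deriv t hd0
  rw [hdt, natDegree_neg] at h1
  have h2 := sum_sub_one (fun b => t.rootMultiplicity b)
  have h3 : (Finset.univ.filter fun b => 0 < t.rootMultiplicity b).card ≤ p ^ h := by
    rw [← hq]; exact Finset.card_filter_le _ _
  have h4 : M ≤ p ^ e * ∑ b, t.rootMultiplicity b := by
    rw [← hN, Finset.mul_sum]
    exact Finset.sum_le_sum fun b _ => mult_pow t ht0 b _ _ (hdvd b)
  have h5 : M ≤ p ^ e * ((derivative g).natDegree + p ^ h) :=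
    h4.trans (Nat.mul_le_mul_left _ (by omega))
  have hgd : g.natDegree ≠ 0 := by
    intro h0
    apply hne
    rw [natDegree_eq_zero.mp h0 |>.choose_spec.symm]; simp
  have h6 : (derivative g).natDegree + 1 ≤ g.natDegree := natDegree_derivative_lt hgd
  set q := p ^ h with hqd
  have hqq : q ≤ q ^ 2 := by nlinarith
  have hM' : q ^ 2 + 1 ≤ M + q := by omega
  by_cases hc : 2 * p ^ e + 2 ≤ q
  · have h7 : p ^ e * ((derivative g).natDegree + 1) ≤ D := (Nat.mul_le_mul_left _ h6).trans hg
    nlinarith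
  · -- then p = 2 and 2 * p ^ e = q
    push Not at hc
    have hsplit : q = p ^ e * p ^ (h - e) := by rw [hqd, ← pow_add]; congr 1; omega
    have hpk : p ≤ p ^ (h - e) := Nat.le_self_pow (by omega) p
    have hp2 : p = 2 := by
      by_contra hp2
      have h9 := hodd hp2
      have : 3 ≤ p := by have := hp.two_le; omega
      have : p ^ e * 3 ≤ q := by rw [hsplit]; exact Nat.mul_le_mul_left _ (by omega)
      omega
    have hk1 : h - e = 1 := by
      by_contra hk1
      have : p ^ 2 ≤ p ^ (h - e) := Nat.pow_le_pow_right hp.pos (by omega)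
      have : p ^ e * 4 ≤ q := by
        rw [hsplit]; apply Nat.mul_le_mul_left; rw [hp2] at this ⊢; omega
      omega
    have hqe : q = p ^ e * 2 := by rw [hsplit, hk1, hp2]; simp
    have h8 : g.natDegree ≤ q := by
      by_contra h8
      push Not at h8
      have h81 := Nat.mul_le_mul_left (p ^ e) h8
      have h82 : 2 * (p ^ e * q.succ) = q ^ 2 + q := by
        calc 2 * (p ^ e * q.succ) = (p ^ e * 2) * q.succ := by ring
          _ = q * q.succ := by rw [← hqe]
          _ = q ^ 2 + q := by rw [Nat.succ_eq_add_one]; ring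
      omega
    have h9 : (derivative g).natDegree + 2 ≤ q := by
      by_contra h9
      have h10 : (derivative g).natDegree + 1 = q := by omega
      have h11 : (derivative g).coeff (derivative g).natDegree ≠ 0 := by
        simpa using hne
      apply h11
      rw [coeff_derivative]
      have : ((derivative g).natDegree : F) + 1 = 0 := by
        have h12 : (((derivative g).natDegree + 1 : ℕ) : F) = 0 := by
          rw [h10, hqd]; push_cast; rw [CharP.cast_eq_zero, zero_pow (by omega)]
        exact_mod_cast h12
      rw [this, mul_zero]
    have h91 : p ^ e * ((derivative g).natDegree + q) + q ≤ q ^ 2 := by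
      have h92 : (derivative g).natDegree + q + 2 ≤ 2 * q := by omega
      have h93 := Nat.mul_le_mul_left (p ^ e) h92
      have h94 : p ^ e * (2 * q) = q ^ 2 := by
        calc p ^ e * (2 * q) = (p ^ e * 2) * q := by ring
          _ = q * q := by rw [← hqe]
          _ = q ^ 2 := by ring
      have h95 : p ^ e * ((derivative g).natDegree + q + 2) =
          p ^ e * ((derivative g).natDegree + q) + p ^ e * 2 := by ring
      omega
    omega

lemma redei_pow (p h : ℕ) [Fact p.Prime] [CharP F p] (hq : Fintype.card F = p ^ h)
    (hq4 : 4 ≤ p ^ h) (hodd : p ≠ 2 → 9 < p ^ h) (D M : ℕ) (hD : 2 * D + 2 = (p ^ h) ^ 2 + p ^ h)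
    (hM : (p ^ h) ^ 2 - p ^ h < M) (N : F → ℕ) (hN : ∑ b, N b = M) (g0 : F[X])
    (hg0 : g0.natDegree ≤ D)
    (hdvd : ∀ b, (X - C b) ^ N b ∣ X ^ ((p ^ h) ^ 2) - g0) (e : ℕ) (he : e ≤ h) :
    ∃ g : F[X], g0 = g ^ (p ^ e) := by
  induction e with
  | zero => exact ⟨g0, by simp⟩
  | succ e ih =>
    obtain ⟨g, hg⟩ := ih (by omega)
    have hd : derivative g = 0 := by
      refine redei_step p h e hq hq4 hodd (by omega) D M hD hM N hN g ?_ ?_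
      · rw [← natDegree_pow, ← hg]; exact hg0
      · intro b
        rw [sub_pow_char_pow, ← pow_mul, ← pow_add, ← hg]
        have : 2 * h - e + e = h * 2 := by omega
        rw [this, pow_mul]; exact hdvd b
    obtain ⟨r, hr⟩ := pth_root p g hd
    refine ⟨r, ?_⟩
    rw [hg, hr, ← pow_mul, pow_succ, mul_comm p]

lemma redei (p h : ℕ) [Fact p.Prime] [CharP F p] (hq : Fintype.card F = p ^ h)
    (hq4 : 4 ≤ p ^ h) (hodd : p ≠ 2 → 9 < p ^ h) (D M : ℕ) (hD : 2 * D + 2 = (p ^ h) ^ 2 + p ^ h)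
    (hM : (p ^ h) ^ 2 - p ^ h < M) (N : F → ℕ) (hN : ∑ b, N b = M) (g0 : F[X])
    (hg0 : g0.natDegree ≤ D)
    (hdvd : ∀ b, (X - C b) ^ N b ∣ X ^ ((p ^ h) ^ 2) - g0) :
    (∀ b, N b ≤ p ^ h) ∨ 2 * (Finset.univ.filter fun b => 0 < N b).card ≤ p ^ h := by
  have hp : p.Prime := Fact.out
  obtain ⟨g, hg⟩ := redei_pow p h hq hq4 hodd D M hD hM N hN g0 hg0 hdvd h le_rfl
  have hh : h ≠ 0 := by rintro rfl; simp at hq4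
  have hdeg : p ^ h * g.natDegree ≤ D := by rw [← natDegree_pow, ← hg]; exact hg0
  have hdvd' : ∀ b, (X - C b) ^ N b ∣ (X ^ (p ^ h) - g) ^ (p ^ h) := by
    intro b
    rw [sub_pow_char_pow, ← pow_mul, ← hg, ← sq]; exact hdvd b
  obtain ⟨h', rfl⟩ : ∃ h', h = h' + 1 := ⟨h - 1, by omega⟩
  have hqp : p ^ (h' + 1) = p ^ h' * p := pow_succ _ _
  have hq0 : ((p ^ (h' + 1) : ℕ) : F[X]) = 0 := by
    push_cast; rw [CharP.cast_eq_zero, zero_pow hh]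
  set q := p ^ (h' + 1) with hqd
  have hqq : q ≤ q ^ 2 := by nlinarith
  have hM' : q ^ 2 + 1 ≤ M + q := by omega
  have hd2 : 2 * g.natDegree ≤ q := by
    by_contra hc
    push Not at hc
    have := Nat.mul_le_mul_left q hc
    nlinarith
  obtain ⟨htd, ht0⟩ := X_pow_sub_ne q g (by omega)
  by_cases hd : derivative g = 0
  · right
    obtain ⟨r, hr⟩ := pth_root p g hd
    have hv : X ^ q - g = (X ^ (p ^ h') - r) ^ p := by
      rw [sub_pow_char, ← pow_mul, ← hqp, ← hr]
    have hrd : g.natDegree = p * r.natDegree := by rw [hr, natDegree_pow]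
    obtain ⟨hvd, hv0⟩ := X_pow_sub_ne (p ^ h') r (by
      by_contra hc
      push Not at hc
      have := Nat.mul_le_mul_left p hc
      rw [← hrd, mul_comm, ← hqp] at this
      omega)
    set v := X ^ (p ^ h') - r
    have hK : (Finset.univ.filter fun b => 0 < N b).card ≤ p ^ h' := by
      rw [← hvd]
      refine le_trans (Finset.card_le_card (t := v.roots.toFinset) ?_)
        ((Multiset.toFinset_card_le _).trans (card_roots' v))
      intro b hb
      simp only [Finset.mem_filter, Finset.mem_univ, true_and] at hb
      rw [Multiset.mem_toFinset, mem_roots hv0, ← dvd_iff_isRoot]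
      have h1 : X - C b ∣ (X - C b) ^ N b := dvd_pow_self _ (by omega)
      have h2 := h1.trans (hdvd' b)
      rw [hv, ← pow_mul] at h2
      exact (prime_X_sub_C b).dvd_of_dvd_pow h2
    have := hp.two_le
    rw [hqp]; nlinarith
  · left
    set t := X ^ q - g with ht
    have hdt : derivative t = - derivative g := by
      rw [ht]
      simp only [derivative_sub, derivative_X_pow, map_natCast, hq0]
      simp
    have h1 := sum_rootMult_deriv t (by rw [hdt]; simpa using hd)
    rw [hdt, natDegree_neg] at h1
    have h2 := sum_sub_one (fun b => t.rootMultiplicity b)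
    have h4 : M ≤ q * ∑ b, t.rootMultiplicity b := by
      rw [← hN, Finset.mul_sum]
      exact Finset.sum_le_sum fun b _ => mult_pow t ht0 b _ _ (hdvd' b)
    have h5 : q ≤ ∑ b, t.rootMultiplicity b := by
      by_contra hc
      push Not at hc
      have := Nat.mul_le_mul_left q hc
      nlinarith
    have hgd : g.natDegree ≠ 0 := by
      intro h0
      apply hd
      rw [natDegree_eq_zero.mp h0 |>.choose_spec.symm]; simp
    have h6 : (derivative g).natDegree + 1 ≤ g.natDegree := natDegree_derivative_lt hgd
    have hXg : X - g = 0 := by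
      by_contra hXg
      have h7 : (Finset.univ.filter fun b => 0 < t.rootMultiplicity b).card ≤ (X - g).natDegree := by
        refine le_trans (Finset.card_le_card (t := (X - g).roots.toFinset) ?_)
          ((Multiset.toFinset_card_le _).trans (card_roots' _))
        intro b hb
        simp only [Finset.mem_filter, Finset.mem_univ, true_and] at hb
        rw [Multiset.mem_toFinset, mem_roots hXg]
        have hb' := (rootMultiplicity_pos ht0).mp hb
        rw [IsRoot.def, ht] at hb'
        simp only [eval_sub, eval_pow, eval_X] at hb'
        rw [← hq, FiniteField.pow_card] at hb'
        simpa using hb'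
      have h8 : (X - g).natDegree ≤ max (X : F[X]).natDegree g.natDegree := natDegree_sub_le _ _
      rw [natDegree_X, max_eq_right (by omega)] at h8
      omega
    have hgX : g = X := (sub_eq_zero.mp hXg).symm
    intro b
    have h9 := mult_pow t ht0 b _ _ (hdvd' b)
    have h10 : t.rootMultiplicity b ≤ 1 := by
      by_contra hc
      push Not at hc
      have := (rootMultiplicity_sub_one_le_derivative_rootMultiplicity_of_ne_zero t b (by rw [hdt]; simpa using hd))
      rw [hdt, hgX] at this
      have h0 : rootMultiplicity b (-derivative (X:F[X])) = 0 := rootMultiplicity_eq_zero (by simp [IsRoot.def])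
      rw [h0] at this
      omega
    nlinarith
end redei

/-- weight condition with top part -/
def WW {F : Type*} [Field F] (n : ℕ) (ρ : F[X][X]) (s : F[X]) : Prop :=
  ∀ i, (i ≤ n → (ρ.coeff i).natDegree ≤ 2 * (n - i) ∧ (ρ.coeff i).coeff (2 * (n - i)) = s.coeff i) ∧
    (n < i → ρ.coeff i = 0 ∧ s.coeff i = 0)

section biv
variable {F : Type*} [Field F]

lemma WW.sub {n : ℕ} {ρ ρ' : F[X][X]} {s s' : F[X]} (h : WW n ρ s) (h' : WW n ρ' s') :
    WW n (ρ - ρ') (s - s') := by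
  intro i
  refine ⟨fun hi => ?_, fun hi => ?_⟩
  · have h1 := (h i).1 hi
    have h2 := (h' i).1 hi
    simp only [coeff_sub]
    refine ⟨(natDegree_sub_le _ _).trans (max_le h1.1 h2.1), ?_⟩
    rw [h1.2, h2.2]
  · simp [((h i).2 hi), ((h' i).2 hi)]

lemma WW.X_mul {n : ℕ} {ρ : F[X][X]} {s : F[X]} (h : WW n ρ s) : WW (n + 1) (X * ρ) (X * s) := by
  intro i
  cases i with
  | zero => simp
  | succ i =>
    simp only [coeff_X_mul, Nat.add_sub_add_right]
    refine ⟨fun hi => (h i).1 (by omega), fun hi => (h i).2 (by omega)⟩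

lemma WW.smul {n e : ℕ} {ρ : F[X][X]} {s : F[X]} (h : WW n ρ s) (c : F[X]) (hc : c.natDegree ≤ 2 * e) :
    WW (n + e) (C c * ρ) (C (c.coeff (2 * e)) * s) := by
  intro i
  simp only [coeff_C_mul]
  by_cases hi : i ≤ n
  · refine ⟨fun _ => ?_, fun h => by omega⟩
    have h1 := (h i).1 hi
    have e1 : 2 * (n + e - i) = 2 * e + 2 * (n - i) := by omega
    rw [e1]
    refine ⟨natDegree_mul_le.trans (add_le_add hc h1.1), ?_⟩
    rw [coeff_mul_add_eq_of_natDegree_le hc h1.1, h1.2]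
  · have h1 := (h i).2 (by omega)
    simp [h1]

lemma WW.one : WW 0 (1 : F[X][X]) (1 : F[X]) := by
  intro i
  refine ⟨fun hi => ?_, fun hi => ?_⟩
  · obtain rfl : i = 0 := by omega
    simp
  · simp [coeff_one, hi.ne']

lemma WW.X_pow (n : ℕ) : WW n (X ^ n : F[X][X]) (X ^ n : F[X]) := by
  induction n with
  | zero => simpa using WW.one
  | succ n ih => rw [pow_succ', pow_succ']; exact ih.X_mul

lemma WW.prod [DecidableEq F] (U : Finset F[X]) (hU : ∀ f ∈ U, f.natDegree ≤ 2) :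
    WW U.card (∏ f ∈ U, (X - C f) : F[X][X]) (∏ f ∈ U, (X - C (f.coeff 2))) := by
  classical
  induction U using Finset.induction_on with
  | empty => simpa using WW.one
  | insert f U hf ih =>
    rw [Finset.prod_insert hf, Finset.prod_insert hf, Finset.card_insert_of_notMem hf]
    have h := ih (fun g hg => hU g (Finset.mem_insert_of_mem hg))
    rw [sub_mul, sub_mul]
    exact h.X_mul.sub (h.smul (e := 1) f (hU f (Finset.mem_insert_self _ _)))

lemma WW.div [DecidableEq F] {M : ℕ} (hM : 0 < M) {R : F[X][X]} {S : F[X]} (hR : WW M R S) (hRM : R.coeff M = 1)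
    (hSM : S.coeff M = 1) (e : ℕ) :
    ∃ ρ s, WW (M - 1 + e) ρ s ∧ (∀ i, M ≤ i → ρ.coeff i = 0) ∧ (∀ i, M ≤ i → s.coeff i = 0) ∧
      R ∣ X ^ (M - 1 + e) - ρ ∧ S ∣ X ^ (M - 1 + e) - s := by
  induction e with
  | zero =>
    refine ⟨X ^ (M - 1), X ^ (M - 1), WW.X_pow _, ?_, ?_, by simp, by simp⟩
    · intro i hi
      rw [coeff_X_pow, if_neg (by omega)]
    · intro i hi
      rw [coeff_X_pow, if_neg (by omega)]
  | succ e ih =>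
    obtain ⟨ρ, s, h1, h2, h3, h4, h5⟩ := ih
    have h6 := (h1 (M - 1)).1 (by omega)
    have e1 : 2 * (M - 1 + e - (M - 1)) = 2 * e := by omega
    rw [e1] at h6
    have h7 := hR.smul (e := e) _ h6.1
    rw [h6.2, show M + e = M - 1 + e + 1 by omega] at h7
    refine ⟨_, _, h1.X_mul.sub h7, ?_, ?_, ?_, ?_⟩
    · intro i hi
      obtain ⟨j, rfl⟩ : ∃ j, i = j + 1 := ⟨i - 1, by omega⟩
      rw [coeff_sub, coeff_X_mul, coeff_C_mul]
      rcases hi.eq_or_lt with hi | hi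
      · rw [← hi, hRM, show j = M - 1 by omega]; simp
      · rw [((hR _).2 hi).1, h2 j (by omega)]; simp
    · intro i hi
      obtain ⟨j, rfl⟩ : ∃ j, i = j + 1 := ⟨i - 1, by omega⟩
      rw [coeff_sub, coeff_X_mul, coeff_C_mul]
      rcases hi.eq_or_lt with hi | hi
      · rw [← hi, hSM, show j = M - 1 by omega]; simp
      · rw [((hR _).2 hi).2, h3 j (by omega)]; simp
    · have : (X : F[X][X]) ^ (M - 1 + (e + 1)) - (X * ρ - C (ρ.coeff (M - 1)) * R)
        = X * (X ^ (M - 1 + e) - ρ) + C (ρ.coeff (M - 1)) * R := by ring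
      rw [this]
      exact dvd_add (h4.mul_left _) (dvd_mul_left _ _)
    · have : (X : F[X]) ^ (M - 1 + (e + 1)) - (X * s - C (s.coeff (M - 1)) * S)
        = X * (X ^ (M - 1 + e) - s) + C (s.coeff (M - 1)) * S := by ring
      rw [this]
      exact dvd_add (h5.mul_left _) (dvd_mul_left _ _)

/-- uniqueness of remainders -/
lemma rem_unique {K : Type*} [Field K] {M : ℕ} {R P r t : K[X]} (hR : R.Monic) (hd : R.natDegree = M)
    (h1 : R ∣ P - r) (h2 : R ∣ P - t) (hr : ∀ i, M ≤ i → r.coeff i = 0)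
    (ht : ∀ i, M ≤ i → t.coeff i = 0) : r = t := by
  have h3 : R ∣ r - t := by
    have := dvd_sub h2 h1
    simpa using this
  by_contra hne
  have h4 := natDegree_le_of_dvd h3 (sub_ne_zero.mpr hne)
  have h5 : (r - t).coeff (r - t).natDegree = 0 := by
    rw [coeff_sub, hr _ (by omega), ht _ (by omega), sub_zero]
  exact hne (sub_eq_zero.mp (leadingCoeff_eq_zero.mp h5))

lemma aeval_inj {L : Type*} [Field L] [Algebra F L] (θ : L) (hθ : ∀ x : F, algebraMap F L x ≠ θ)
    (f g : F[X]) (hf : f.natDegree ≤ 2) (hg : g.natDegree ≤ 2) (x : F) (hx : f.eval x = g.eval x)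
    (h : aeval θ f = aeval θ g) : f = g := by
  have h1 : (f - g).IsRoot x := by simp [hx]
  obtain ⟨e, he⟩ := dvd_iff_isRoot.mpr h1
  have hd : (f - g).natDegree ≤ 2 := (natDegree_sub_le _ _).trans (max_le hf hg)
  rcases eq_or_ne e 0 with he0 | he0
  · rw [he0, mul_zero] at he
    exact sub_eq_zero.mp he
  exfalso
  have hde : e.natDegree ≤ 1 := by
    rw [he, natDegree_mul (X_sub_C_ne_zero x) he0, natDegree_X_sub_C] at hd
    omega
  have h2 : aeval θ e = 0 := by
    have : aeval θ (f - g) = 0 := by simp [h]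
    rw [he, map_mul] at this
    rcases mul_eq_zero.mp this with h3 | h3
    · exfalso
      simp [sub_eq_zero] at h3
      exact hθ x h3.symm
    · exact h3
  have h3 := eq_X_add_C_of_natDegree_le_one hde
  rw [h3] at h2
  simp at h2
  by_cases ha : e.coeff 1 = 0
  · simp [ha] at h2
    apply he0
    rw [h3, ha, h2]; simp
  · apply hθ (-(e.coeff 0) / e.coeff 1)
    have ha' : algebraMap F L (e.coeff 1) ≠ 0 := by simpa using ha
    rw [map_div₀, map_neg, div_eq_iff ha']
    linear_combination -h2

lemma X_pow_card_prod (K : Type*) [Field K] [Fintype K] :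
    (X : K[X]) ^ Fintype.card K - X = ∏ a : K, (X - C a) := by
  have h1 := FiniteField.roots_X_pow_card_sub_X K
  have hd := FiniteField.X_pow_card_sub_X_natDegree_eq K (Fintype.one_lt_card (α := K))
  have hm : ((X : K[X]) ^ Fintype.card K - X).Monic := by
    apply monic_X_pow_sub
    rw [degree_X]
    exact_mod_cast Fintype.one_lt_card
  have h2 := prod_multiset_X_sub_C_of_monic_of_roots_card_eq hm (by rw [h1, hd]; rfl)
  rw [← h2, h1]
  rfl

lemma prod_fiber [Fintype F] [DecidableEq F] (U : Finset F[X]) (φ : F[X] → F) :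
    (∏ f ∈ U, (X - C (φ f)) : F[X]) = ∏ a : F, (X - C a) ^ (U.filter fun f => φ f = a).card := by
  rw [← Finset.prod_fiberwise U φ]
  refine Finset.prod_congr rfl fun a _ => ?_
  rw [← Finset.prod_const]
  refine Finset.prod_congr rfl fun f hf => ?_
  rw [(Finset.mem_filter.mp hf).2]

/-- at most `q` members of `U` have a given second coefficient -/
lemma fiber_two [Fintype F] [DecidableEq F] (U : Finset F[X]) (hU : ∀ f ∈ U, f.natDegree ≤ 2)
    (hint : ∀ f ∈ U, ∀ g ∈ U, ∃ x : F, f.eval x = g.eval x) (a : F) :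
    (U.filter fun f => f.coeff 2 = a).card ≤ Fintype.card F := by
  refine Finset.card_le_card_of_injOn (t := Finset.univ) (fun f => f.coeff 1) (by simp) ?_
  intro f hf g hg hfg
  simp only [Finset.coe_filter, Set.mem_ofPred_eq] at hf hg hfg
  obtain ⟨x, hx⟩ := hint f hf.1 g hg.1
  have hd : ∀ f : F[X], f.natDegree ≤ 2 → f = C (f.coeff 2) * X ^ 2 + C (f.coeff 1) * X + C (f.coeff 0) := by
    intro f hf
    exact eq_quadratic_of_degree_le_two (natDegree_le_iff_degree_le.mp hf)
  have h1 := hd f (hU f hf.1)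
  have h2 := hd g (hU g hg.1)
  rw [h1, h2, hf.2, hg.2, hfg] at hx
  simp at hx
  rw [h1, h2, hf.2, hg.2, hfg, hx]

lemma Rinf_dvd [Fintype F] [DecidableEq F] (p h : ℕ) [Fact p.Prime] [CharP F p]
    (hq : Fintype.card F = p ^ h)
    (U : Finset F[X]) (hU : ∀ f ∈ U, f.natDegree ≤ 2)
    (hint : ∀ f ∈ U, ∀ g ∈ U, ∃ x : F, f.eval x = g.eval x) :
    (∏ f ∈ U, (X - C (f.coeff 2)) : F[X]) ∣ X ^ ((p ^ h) ^ 2) - X ^ (p ^ h) := by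
  have h1 : (X : F[X]) ^ ((p ^ h) ^ 2) - X ^ (p ^ h) = ∏ a : F, (X - C a) ^ (p ^ h) := by
    rw [Finset.prod_pow, ← X_pow_card_prod, hq, sub_pow_char_pow, sq (p ^ h), pow_mul]
  rw [h1, prod_fiber]
  refine Finset.prod_dvd_prod_of_dvd _ _ fun a _ => pow_dvd_pow _ ?_
  rw [← hq]
  exact fiber_two U hU hint a

lemma card_U_le [Fintype F] [DecidableEq F]
    (U : Finset F[X]) (hU : ∀ f ∈ U, f.natDegree ≤ 2)
    (hint : ∀ f ∈ U, ∀ g ∈ U, ∃ x : F, f.eval x = g.eval x) :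
    U.card ≤ Fintype.card F ^ 2 := by
  rw [Finset.card_eq_sum_card_fiberwise (f := fun f : F[X] => f.coeff 2) (t := Finset.univ) (by intro x; simp)]
  refine (Finset.sum_le_sum fun a _ => fiber_two U hU hint a).trans ?_
  simp [sq]

lemma biv_main [Fintype F] [DecidableEq F] (p h : ℕ) [Fact p.Prime] [CharP F p]
    (hq : Fintype.card F = p ^ h) (hq4 : 4 ≤ p ^ h)
    (U : Finset F[X]) (hU : ∀ f ∈ U, f.natDegree ≤ 2)
    (hint : ∀ f ∈ U, ∀ g ∈ U, ∃ x : F, f.eval x = g.eval x)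
    (hM : (p ^ h) ^ 2 - p ^ h < U.card)
    (L : Type*) [Field L] [Fintype L] [Algebra F L] (hL : Fintype.card L = (p ^ h) ^ 2)
    (D : ℕ) (hD : 2 * D + 2 = (p ^ h) ^ 2 + p ^ h) (α : F) :
    ∃ g0 : F[X], g0.natDegree ≤ D ∧
      (∏ f ∈ U, (X - C (f.eval α))) ∣ X ^ ((p ^ h) ^ 2) - g0 := by
  classical
  have hcard := card_U_le U hU hint
  rw [hq] at hcard
  have hRi := Rinf_dvd p h hq U hU hint
  set q := p ^ h with hqd
  have hqq : 4 * q ≤ q ^ 2 := by nlinarith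
  set M := U.card with hMd
  have hM0 : 0 < M := by omega
  have hRmonic : (∏ f ∈ U, (X - C f) : F[X][X]).Monic := monic_prod_of_monic _ _ fun f _ => monic_X_sub_C f
  have hRdeg : (∏ f ∈ U, (X - C f) : F[X][X]).natDegree = M := by
    rw [natDegree_prod_of_monic _ _ fun f _ => monic_X_sub_C f]; simp [hMd]
  have hSmonic : (∏ f ∈ U, (X - C (f.coeff 2)) : F[X]).Monic :=
    monic_prod_of_monic _ _ fun f _ => monic_X_sub_C _
  have hSdeg : (∏ f ∈ U, (X - C (f.coeff 2)) : F[X]).natDegree = M := by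
    rw [natDegree_prod_of_monic _ _ fun f _ => monic_X_sub_C _]; simp [hMd]
  obtain ⟨ρ, s, hW, hρM, hsM, hRd, hSd⟩ := (WW.prod U hU).div hM0
    (by rw [← hRdeg]; exact hRmonic) (by rw [← hSdeg]; exact hSmonic) (q ^ 2 + 1 - M)
  rw [show M - 1 + (q ^ 2 + 1 - M) = q ^ 2 by omega] at hW hRd hSd
  have hs : s = X ^ q := by
    refine rem_unique hSmonic hSdeg hSd hRi hsM ?_
    intro i hi
    rw [coeff_X_pow, if_neg (by omega)]
  -- specialisation at points outside the ground field
  have hθ : ∀ θ : L, (∀ x : F, algebraMap F L x ≠ θ) → ∀ i, 2 ≤ i → aeval θ (ρ.coeff i) = 0 := by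
    intro θ hθ i hi
    let φ : F[X] →+* L := (aeval θ : F[X] →ₐ[F] L).toRingHom
    have hm1 : (∏ f ∈ U, (X - C (aeval θ f)) : L[X]).Monic :=
      monic_prod_of_monic _ _ fun f _ => monic_X_sub_C _
    have hm2 : (∏ f ∈ U, (X - C (aeval θ f)) : L[X]).natDegree = M := by
      rw [natDegree_prod_of_monic _ _ fun f _ => monic_X_sub_C _]; simp [hMd]
    have hm3 : (∏ f ∈ U, (X - C (aeval θ f)) : L[X]) ∣ X ^ (q ^ 2) - ρ.map φ := by
      have := Polynomial.map_dvd φ hRd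
      simpa [Polynomial.map_prod, φ] using this
    have hm4 : (∏ f ∈ U, (X - C (aeval θ f)) : L[X]) ∣ X ^ (q ^ 2) - X := by
      rw [← hL, X_pow_card_prod,
        ← Finset.prod_image (s := U) (g := fun f => aeval θ f) (f := fun t : L => (X - C t : L[X]))]
      · exact Finset.prod_dvd_prod_of_subset _ _ _ (Finset.subset_univ _)
      · intro f hf g hg hfg
        obtain ⟨x, hx⟩ := hint f hf g hg
        exact aeval_inj θ hθ f g (hU f hf) (hU g hg) x hx hfg
    have hm5 : ρ.map φ = X := by
      refine rem_unique hm1 hm2 hm3 hm4 ?_ ?_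
      · intro i hi
        rw [coeff_map, hρM i hi, map_zero]
      · intro i hi
        rw [coeff_X, if_neg (by omega)]
    have := congrArg (fun P : L[X] => P.coeff i) hm5
    simp only [coeff_map, coeff_X] at this
    rw [if_neg (by omega)] at this
    exact this
  have hzero : ∀ i, D < i → ρ.coeff i = 0 := by
    intro i hi
    by_cases hiq : q ^ 2 < i
    · exact ((hW i).2 hiq).1
    have hw := (hW i).1 (by omega)
    rw [hs, coeff_X_pow, if_neg (by omega)] at hw
    by_contra hne
    have hlt : (ρ.coeff i).natDegree < 2 * (q ^ 2 - i) := by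
      refine lt_of_le_of_ne hw.1 fun h => ?_
      rw [← h] at hw
      exact hne (leadingCoeff_eq_zero.mp hw.2)
    apply hne
    apply map_injective _ (algebraMap F L).injective
    rw [Polynomial.map_zero]
    refine eq_zero_of_natDegree_lt_card_of_eval_eq_zero' _
      (Finset.univ \ Finset.univ.image (algebraMap F L)) ?_ ?_
    · intro θ hθ'
      rw [eval_map_algebraMap]
      refine hθ θ (fun x hx => ?_) i (by omega)
      simp at hθ'
      exact hθ' x hx
    · rw [Finset.card_sdiff_of_subset (Finset.subset_univ _),
        Finset.card_image_of_injective _ (algebraMap F L).injective,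
        Finset.card_univ, Finset.card_univ, hL, hq, natDegree_map]
      omega
  refine ⟨ρ.map (evalRingHom α), ?_, ?_⟩
  · rw [natDegree_le_iff_coeff_eq_zero]
    intro i hi
    rw [coeff_map, hzero i hi, map_zero]
  · have := Polynomial.map_dvd (evalRingHom α) hRd
    simpa [Polynomial.map_prod] using this
end biv

section base
variable {F : Type*} [Field F] [Fintype F] [DecidableEq F]

lemma pair_count (U : Finset F[X])
    (hint : ∀ f ∈ U, ∀ g ∈ U, ∃ x : F, f.eval x = g.eval x)
    (hM : Fintype.card F ^ 2 - Fintype.card F < U.card)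
    (hle : ∀ α β : F, (U.filter fun f => f.eval α = β).card ≤ Fintype.card F) : False := by
  set q := Fintype.card F with hq
  have hq2 : 1 < q := Fintype.one_lt_card
  have hqq : q ≤ q ^ 2 := by nlinarith
  have key : ∀ f ∈ U, U.card - 1 + q ≤ ∑ α : F, (U.filter fun g => g.eval α = f.eval α).card := by
    intro f hf
    simp_rw [Finset.card_filter]
    rw [Finset.sum_comm, ← Finset.add_sum_erase _ _ hf]
    have h1 : ∑ α : F, (if f.eval α = f.eval α then 1 else 0) = q := by simp [hq]
    rw [h1, add_comm]
    gcongr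
    rw [← Finset.card_erase_of_mem hf, Finset.card_eq_sum_ones]
    refine Finset.sum_le_sum fun g hg => ?_
    obtain ⟨x, hx⟩ := hint g (Finset.mem_of_mem_erase hg) f hf
    refine le_trans ?_ (Finset.single_le_sum (fun _ _ => Nat.zero_le _) (Finset.mem_univ x))
    simp [hx]
  have hup : ∀ f : F[X], ∑ α : F, (U.filter fun g => g.eval α = f.eval α).card ≤ ∑ α : F, q :=
    fun f => Finset.sum_le_sum fun α _ => hle α _
  have hs : ∑ α : F, q = q ^ 2 := by simp [hq, sq]
  have hne : U.Nonempty := Finset.card_pos.mp (by omega)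
  obtain ⟨f0, hf0⟩ := hne
  have hMeq : U.card + q = q ^ 2 + 1 := by
    have h1 := key f0 hf0
    have h2 := hup f0
    omega
  have hval : ∀ f ∈ U, (U.filter fun g => g.eval 0 = f.eval 0).card = q := by
    intro f hf
    have h1 := key f hf
    have h2 := hup f
    have h3 := (Finset.sum_eq_sum_iff_of_le (s := Finset.univ) (fun α _ => hle α (f.eval α))).mp (by omega)
    exact h3 0 (Finset.mem_univ _)
  have hdv : q ∣ U.card := by
    rw [Finset.card_eq_sum_card_fiberwise (f := fun f : F[X] => f.eval 0) (t := Finset.univ)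
      (by intro x; simp)]
    refine Finset.dvd_sum fun β _ => ?_
    rcases Finset.eq_empty_or_nonempty (U.filter fun f => f.eval 0 = β) with h | ⟨f, hf⟩
    · rw [h]; simp
    · rw [Finset.mem_filter] at hf
      have := hval f hf.1
      rw [hf.2] at this
      rw [this]
  have h1 : q ∣ q ^ 2 + 1 := hMeq ▸ dvd_add hdv dvd_rfl
  have h2 : q ∣ 1 := (Nat.dvd_add_right (Dvd.intro_left (q ^ (2 - 1)) (by ring))).mp h1
  have := Nat.le_of_dvd one_pos h2
  omega

lemma arith (q M A K : ℤ) (hq : 4 ≤ q) (hM : q ^ 2 - q + 1 ≤ M) (hA : 2 * q - 1 ≤ A)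
    (hA2 : 2 * A ≤ q ^ 2 + q - 1) (hK : 2 * K ≤ q)
    (h : (M - A) * (A - (q - 1)) ^ 2 ≤ (K - 1) * (A * (q ^ 2 - q))) : False := by
  obtain ⟨u, rfl⟩ : ∃ u, A = 2 * q - 1 + u := ⟨A - (2 * q - 1), by ring⟩
  have hu : 0 ≤ u := by linarith
  obtain ⟨m, hm⟩ : ∃ m, m = q ^ 2 - 3 * q + 2 := ⟨_, rfl⟩
  have hm1 : 2 * u + 1 ≤ m := by linarith
  have hm2 : 3 * q ≤ 2 * m := by nlinarith
  have h1 : (m - u) * (q + u) ^ 2 ≤ (M - (2 * q - 1 + u)) * (2 * q - 1 + u - (q - 1)) ^ 2 := by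
    have e : 2 * q - 1 + u - (q - 1) = q + u := by ring
    rw [e]
    exact mul_le_mul_of_nonneg_right (by linarith) (sq_nonneg _)
  have h2 : 2 * ((K - 1) * ((2 * q - 1 + u) * (q ^ 2 - q))) ≤ m * (q * (2 * q - 1 + u)) := by
    have : 0 ≤ (2 * q - 1 + u) * (q ^ 2 - q) := mul_nonneg (by linarith) (by nlinarith)
    have h3 : (2 * K) * ((2 * q - 1 + u) * (q ^ 2 - q)) ≤ q * ((2 * q - 1 + u) * (q ^ 2 - q)) :=
      mul_le_mul_of_nonneg_right hK this
    rw [hm]; nlinarith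
  have h3 : 2 * ((m - u) * (q + u) ^ 2) ≤ m * (q * (2 * q - 1 + u)) := by linarith
  have hqu : 0 ≤ q * u := by positivity
  have p1 : 0 ≤ (2 * m - 3 * q) * (q * u) := mul_nonneg (by linarith) hqu
  have p2 : 0 ≤ (m - 2 * u - 1) * (q * u) := mul_nonneg (by linarith) hqu
  have p3 : 0 ≤ (2 * m - 3 * q) * u ^ 2 := mul_nonneg (by linarith) (sq_nonneg _)
  have p4 : 0 ≤ (m - 2 * u - 1) * u ^ 2 := mul_nonneg (by linarith) (sq_nonneg _)
  have p5 : 0 < m * q := mul_pos (by linarith) (by linarith)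
  have p6 : 0 ≤ q * u ^ 2 := by positivity
  have p7 : 0 ≤ u ^ 2 := sq_nonneg _
  nlinarith

/-- coordinates of a quadratic polynomial at `α` -/
noncomputable def pt (α : F) (f : F[X]) : F × F := ((taylor α f).coeff 1, (taylor α f).coeff 2)

lemma taylor_quad (α : F) (f : F[X]) (hf : f.natDegree ≤ 2) :
    taylor α f = C (pt α f).2 * X ^ 2 + C (pt α f).1 * X + C (f.eval α) := by
  have h1 : (taylor α f).natDegree ≤ 2 := by rwa [natDegree_taylor]
  have h2 := eq_quadratic_of_degree_le_two (natDegree_le_iff_degree_le.mp h1)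
  rw [taylor_coeff_zero] at h2
  exact h2

lemma eval_quad (α : F) (f : F[X]) (hf : f.natDegree ≤ 2) (x : F) :
    f.eval x = (pt α f).2 * (x - α) ^ 2 + (pt α f).1 * (x - α) + f.eval α := by
  have h := taylor_eval α f (x - α)
  rw [taylor_quad α f hf, sub_add_cancel] at h
  rw [← h]; simp

lemma pt_inj (α : F) (f g : F[X]) (hf : f.natDegree ≤ 2) (hg : g.natDegree ≤ 2)
    (h : f.eval α = g.eval α) (hp : pt α f = pt α g) : f = g := by
  apply taylor_injective α
  rw [taylor_quad α f hf, taylor_quad α g hg, h, hp]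

lemma mix_final (hq4 : 4 ≤ Fintype.card F) (U : Finset F[X]) (hU : ∀ f ∈ U, f.natDegree ≤ 2)
    (hint : ∀ f ∈ U, ∀ g ∈ U, ∃ x : F, f.eval x = g.eval x)
    (hM : Fintype.card F ^ 2 - Fintype.card F < U.card) (α : F)
    (hK : 2 * (Finset.univ.filter fun b : F => 0 < (U.filter fun f => f.eval α = b).card).card
      ≤ Fintype.card F) :
    ∃ β : F, ∀ g ∈ U, g.eval α = β := by
  set q := Fintype.card F with hq
  set N : F → ℕ := fun b => (U.filter fun f => f.eval α = b).card with hN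
  obtain ⟨β, -, hβ⟩ := Finset.exists_max_image Finset.univ N ⟨0, Finset.mem_univ _⟩
  refine ⟨β, ?_⟩
  by_contra hcon
  push Not at hcon
  obtain ⟨h0, hh0, hne0⟩ := hcon
  set S := Finset.univ.filter fun b : F => 0 < N b with hS
  change 2 * S.card ≤ q at hK
  have hsum : U.card = ∑ b ∈ S, N b := by
    rw [Finset.card_eq_sum_card_fiberwise (f := fun f : F[X] => f.eval α) (t := Finset.univ)
      (by intro x; simp), hS, Finset.sum_filter]
    refine Finset.sum_congr rfl fun b _ => ?_
    split_ifs with h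
    · rfl
    · simpa [hN] using h
  have hMA : U.card ≤ S.card * N β := by
    rw [hsum, ← smul_eq_mul]
    exact Finset.sum_le_card_nsmul _ _ _ fun b _ => hβ b (Finset.mem_univ _)
  have hqq : q ≤ q ^ 2 := by nlinarith
  have hM' : (q : ℤ) ^ 2 - q + 1 ≤ U.card := by
    have : q ^ 2 + 1 ≤ U.card + q := by omega
    zify at this; linarith
  have hA1 : 2 * (q : ℤ) - 1 ≤ N β := by
    by_contra hc
    push Not at hc
    have h1 : (N β : ℤ) ≤ 2 * q - 2 := by linarith
    have h2 : (U.card : ℤ) ≤ S.card * N β := by exact_mod_cast hMA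
    have h3 : 2 * (S.card : ℤ) ≤ q := by exact_mod_cast hK
    have h4 : 0 ≤ (N β : ℤ) := by positivity
    have h5 : 2 * (S.card : ℤ) * N β ≤ q * N β := mul_le_mul_of_nonneg_right h3 h4
    have h6 : (q : ℤ) * N β ≤ q * (2 * q - 2) := mul_le_mul_of_nonneg_left h1 (by positivity)
    nlinarith
  have hcard : ∀ b, ((U.filter fun f => f.eval α = b).image (pt α)).card = N b := by
    intro b
    apply Finset.card_image_of_injOn
    intro f hf g hg hfg
    simp only [Finset.coe_filter, Set.mem_ofPred_eq] at hf hg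
    exact pt_inj α f g (hU f hf.1) (hU g hg.1) (hf.2.trans hg.2.symm) hfg
  have hmeet : ∀ f ∈ U, ∀ h ∈ U, f.eval α ≠ h.eval α → ∃ y : F, y ≠ 0 ∧
      (pt α h).2 = (f.eval α - h.eval α) * y ^ 2 + ((pt α f).1 - (pt α h).1) * y + (pt α f).2 := by
    intro f hf h hh hne
    obtain ⟨x, hx⟩ := hint f hf h hh
    have hxα : x - α ≠ 0 := by
      intro h0
      rw [sub_eq_zero.mp h0] at hx
      exact hne hx
    refine ⟨(x - α)⁻¹, inv_ne_zero hxα, ?_⟩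
    rw [eval_quad α f (hU f hf), eval_quad α h (hU h hh)] at hx
    field_simp
    linear_combination -hx
  have hmeet' : ∀ b, b ≠ β → ∀ s ∈ (U.filter fun f => f.eval α = b).image (pt α),
      ∀ p ∈ (U.filter fun f => f.eval α = β).image (pt α),
      ∃ y : F, y ≠ 0 ∧ s.2 = (β - b) * y ^ 2 + (p.1 - s.1) * y + p.2 := by
    intro b hb s hs p hp
    simp only [Finset.mem_image, Finset.mem_filter] at hs hp
    obtain ⟨h, ⟨hh, rfl⟩, rfl⟩ := hs
    obtain ⟨f, ⟨hf, rfl⟩, rfl⟩ := hp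
    exact hmeet f hf h hh (Ne.symm hb)
  have hA2 : 2 * (N β : ℤ) ≤ q ^ 2 + q - 1 := by
    have := mix_first (β - h0.eval α) (sub_ne_zero.mpr (Ne.symm hne0))
      ((U.filter fun f => f.eval α = β).image (pt α)) (pt α h0)
      (hmeet' _ hne0 _ (Finset.mem_image_of_mem _ (Finset.mem_filter.mpr ⟨hh0, rfl⟩)))
    rwa [hcard] at this
  have hβS : β ∈ S := by
    rw [hS, Finset.mem_filter]
    refine ⟨Finset.mem_univ _, ?_⟩
    have : (0 : ℤ) < N β := by
      have : (4 : ℤ) ≤ q := by exact_mod_cast hq4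
      linarith
    exact_mod_cast this
  refine arith q U.card (N β) S.card (by exact_mod_cast hq4) hM' hA1 hA2 (by exact_mod_cast hK) ?_
  have hsum2 : (U.card : ℤ) - N β = ∑ b ∈ S.erase β, (N b : ℤ) := by
    rw [hsum, ← Finset.add_sum_erase _ _ hβS]; push_cast; ring
  rw [hsum2, Finset.sum_mul]
  have hc1 : ((S.erase β).card : ℤ) = S.card - 1 := by
    have := Finset.card_erase_add_one hβS
    zify at this; linarith
  rw [← hc1, ← nsmul_eq_mul]
  apply Finset.sum_le_card_nsmul
  intro b hb
  have hbne := Finset.ne_of_mem_erase hb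
  have := mix (β - b) (sub_ne_zero.mpr (Ne.symm hbne))
      ((U.filter fun f => f.eval α = β).image (pt α)) ((U.filter fun f => f.eval α = b).image (pt α))
      (hmeet' b hbne) (by rw [hcard]; zify at hq4 ⊢; omega)
  rwa [hcard, hcard] at this

lemma base_two_aux (p h : ℕ) [Fact p.Prime] [CharP F p]
    (hq : Fintype.card F = p ^ h) (hq4 : 4 ≤ p ^ h) (hodd : p ≠ 2 → 9 < p ^ h)
    (L : Type) [Field L] [Fintype L] [Algebra F L] (hL : Fintype.card L = (p ^ h) ^ 2)
    (U : Finset F[X]) (hU : ∀ f ∈ U, f.natDegree ≤ 2)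
    (hint : ∀ f ∈ U, ∀ g ∈ U, ∃ x : F, f.eval x = g.eval x)
    (hM : Fintype.card F ^ 2 - Fintype.card F < U.card) :
    ∃ α β : F, ∀ g ∈ U, g.eval α = β := by
  by_contra hcon
  refine pair_count U hint hM fun α => ?_
  rw [hq]
  obtain ⟨D, hD⟩ : ∃ D, 2 * D + 2 = (p ^ h) ^ 2 + p ^ h := by
    have h1 : Even ((p ^ h) ^ 2 + p ^ h) := by
      rw [sq, ← Nat.mul_succ]
      exact Nat.even_mul_succ_self _
    obtain ⟨r, hr⟩ := h1
    exact ⟨r - 1, by omega⟩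
  rw [hq] at hM
  obtain ⟨g0, hg0, hdvd⟩ := biv_main p h hq hq4 U hU hint hM L hL D hD α
  rw [prod_fiber U (fun f => f.eval α)] at hdvd
  have hN : ∑ b : F, (U.filter fun f => f.eval α = b).card = U.card :=
    (Finset.card_eq_sum_card_fiberwise (by intro x; simp)).symm
  have hdv : ∀ b : F, (X - C b) ^ (U.filter fun f => f.eval α = b).card ∣ X ^ ((p ^ h) ^ 2) - g0 :=
    fun b => (Finset.dvd_prod_of_mem (fun b : F => (X - C b) ^ (U.filter fun f => f.eval α = b).card)
      (Finset.mem_univ b)).trans hdvd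
  generalize hNN : (fun b : F => (U.filter fun f => f.eval α = b).card) = N
  have hNb : ∀ b : F, (U.filter fun f => f.eval α = b).card = N b := fun b => congrFun hNN b
  simp only [hNb] at hN hdv ⊢
  rcases redei p h hq hq4 hodd D U.card hD hM N hN g0 hg0 hdv with h1 | h1
  · exact h1
  · exfalso
    simp only [← hNb] at h1
    rw [← hq] at h1 hM hq4
    obtain ⟨β, hβ⟩ := mix_final hq4 U hU hint hM α h1
    exact hcon ⟨α, β, hβ⟩
lemma exists_ext (p : ℕ) [Fact p.Prime] [CharP F p] :
    ∃ (L : Type) (_ : Field L) (_ : Fintype L) (_ : Algebra F L),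
      Fintype.card L = (Fintype.card F) ^ 2 := by
  refine ⟨FiniteField.Extension F p 2, inferInstance, Fintype.ofFinite _, inferInstance, ?_⟩
  have h := FiniteField.natCard_extension F p 2
  rw [Nat.card_eq_fintype_card (α := F)] at h
  rw [← h]
  exact (@Nat.card_eq_fintype_card _ (Fintype.ofFinite _)).symm

lemma base_two (p h : ℕ) [Fact p.Prime] [CharP F p]
    (hq : Fintype.card F = p ^ h) (hq4 : 4 ≤ p ^ h) (hodd : p ≠ 2 → 9 < p ^ h)
    (U : Finset F[X]) (hU : ∀ f ∈ U, f.natDegree ≤ 2)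
    (hint : ∀ f ∈ U, ∀ g ∈ U, ∃ x : F, f.eval x = g.eval x)
    (hM : Fintype.card F ^ 2 - Fintype.card F < U.card) :
    ∃ α β : F, ∀ g ∈ U, g.eval α = β := by
  obtain ⟨L, _, _, _, hL⟩ := exists_ext (F := F) p
  exact base_two_aux p h hq hq4 hodd L (by rw [hL, hq]) U hU hint hM
end base

section step
variable {F : Type*} [Field F] [Fintype F] [DecidableEq F]

lemma star_bound (k : ℕ) (V : Finset F[X]) (hV : ∀ v ∈ V, v.natDegree ≤ k) (α β : F)
    (hα : ∀ v ∈ V, v.eval α = β) (γ : F[X]) (hγ : γ.eval α ≠ β)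
    (hm : ∀ v ∈ V, ∃ x : F, γ.eval x = v.eval x) :
    V.card ≤ (Fintype.card F - 1) * Fintype.card F ^ (k - 1) := by
  have hdiff : ∀ v ∈ V, ∀ w ∈ V, (∀ i : Fin (k - 1), v.coeff (i + 2) = w.coeff (i + 2)) →
      v = w + C (v.coeff 1 - w.coeff 1) * (X - C α) := by
    intro v hv w hw h
    have hd : (v - w).natDegree ≤ 1 := by
      rw [natDegree_le_iff_coeff_eq_zero]
      intro i hi
      rw [coeff_sub, sub_eq_zero]
      by_cases hik : k < i
      · rw [coeff_eq_zero_of_natDegree_lt ((hV v hv).trans_lt hik),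
          coeff_eq_zero_of_natDegree_lt ((hV w hw).trans_lt hik)]
      · have := h ⟨i - 2, by omega⟩
        simp only at this
        rwa [show i - 2 + 2 = i by omega] at this
    have h1 := eq_X_add_C_of_natDegree_le_one hd
    have h2 : (v - w).eval α = 0 := by rw [eval_sub, hα v hv, hα w hw, sub_self]
    rw [h1] at h2
    simp only [eval_add, eval_mul, eval_C, eval_X] at h2
    have h3 : (v - w).coeff 0 = -((v - w).coeff 1 * α) := by linear_combination h2
    rw [h3, coeff_sub] at h1
    have h4 : v = w + (v - w) := by ring
    rw [h1] at h4
    rw [h4]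
    simp
    ring
  let key : F[X] → (Fin (k - 1) → F) := fun v i => v.coeff (i + 2)
  refine (Finset.card_le_mul_card_image (f := key) V (Fintype.card F - 1) ?_).trans ?_
  · intro a ha
    obtain ⟨w, hw, hwa⟩ := Finset.mem_image.mp ha
    have hE : ((Finset.univ.erase α).image
        fun x : F => (γ.eval x - w.eval x) / (x - α)).card ≤ Fintype.card F - 1 := by
      refine Finset.card_image_le.trans ?_
      rw [Finset.card_erase_of_mem (Finset.mem_univ _), Finset.card_univ]
    refine le_trans ?_ hE
    refine Finset.card_le_card_of_injOn (fun v => v.coeff 1 - w.coeff 1) ?_ ?_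
    · intro v hv
      simp only [Finset.coe_filter, Set.mem_ofPred_eq] at hv
      have h1 := hdiff v hv.1 w hw fun i => congrFun (hv.2.trans hwa.symm) i
      obtain ⟨x, hx⟩ := hm v hv.1
      have hxα : x ≠ α := by
        rintro rfl
        exact hγ (hx.trans (hα v hv.1))
      rw [Finset.mem_coe, Finset.mem_image]
      refine ⟨x, Finset.mem_erase.mpr ⟨hxα, Finset.mem_univ _⟩, ?_⟩
      rw [div_eq_iff (sub_ne_zero.mpr hxα), hx]
      have h2 := congrArg (eval x) h1
      simp only [eval_add, eval_mul, eval_C, eval_X, eval_sub] at h2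
      linear_combination h2
    · intro v hv v' hv' hvv
      simp only [Finset.coe_filter, Set.mem_ofPred_eq] at hv hv' hvv
      have h1 := hdiff v hv.1 w hw fun i => congrFun (hv.2.trans hwa.symm) i
      have h2 := hdiff v' hv'.1 w hw fun i => congrFun (hv'.2.trans hwa.symm) i
      rw [h1, h2, hvv]
  · gcongr
    refine (Finset.card_le_univ _).trans ?_
    simp

lemma ind_step (k : ℕ) (hk : 1 ≤ k)
    (ih : ∀ U : Finset F[X], (∀ f ∈ U, f.natDegree ≤ k) →
      (∀ f ∈ U, ∀ g ∈ U, ∃ x : F, f.eval x = g.eval x) →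
      Fintype.card F ^ k - Fintype.card F ^ (k - 1) < U.card → ∃ α β : F, ∀ g ∈ U, g.eval α = β)
    (U : Finset F[X]) (hdeg : ∀ f ∈ U, f.natDegree ≤ k + 1)
    (hint : ∀ f ∈ U, ∀ g ∈ U, ∃ x : F, f.eval x = g.eval x)
    (hU : Fintype.card F ^ (k + 1) - Fintype.card F ^ k < U.card) :
    ∃ α β : F, ∀ g ∈ U, g.eval α = β := by
  set q := Fintype.card F with hq
  have hqk : q ^ k = q ^ (k - 1) * q := by rw [← pow_succ]; congr 1; omega
  have hpig : (Finset.univ : Finset F).card * (q ^ k - q ^ (k - 1)) < U.card := by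
    rw [Finset.card_univ, ← hq, Nat.mul_sub, mul_comm q (q ^ (k - 1)), ← hqk, mul_comm, ← pow_succ]
    exact hU
  obtain ⟨c, -, hc⟩ := Finset.exists_lt_card_fiber_of_mul_lt_card_of_maps_to
    (f := fun f : F[X] => f.coeff (k + 1)) (fun f _ => Finset.mem_univ _) hpig
  set V := (U.filter fun f => f.coeff (k + 1) = c).image (fun f => f - C c * X ^ (k + 1)) with hVd
  have hVc : V.card = (U.filter fun f => f.coeff (k + 1) = c).card :=
    Finset.card_image_of_injective _ (sub_left_injective)
  have hVmem : ∀ v ∈ V, v + C c * X ^ (k + 1) ∈ U ∧ v.natDegree ≤ k := by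
    intro v hv
    obtain ⟨f, hf, rfl⟩ := Finset.mem_image.mp hv
    rw [Finset.mem_filter] at hf
    refine ⟨by rw [sub_add_cancel]; exact hf.1, ?_⟩
    rw [natDegree_le_iff_coeff_eq_zero]
    intro i hi
    rw [coeff_sub, coeff_C_mul, coeff_X_pow]
    split_ifs with h
    · rw [h, hf.2]; ring
    · rw [coeff_eq_zero_of_natDegree_lt ((hdeg f hf.1).trans_lt (by omega))]; ring
  obtain ⟨α, β, hαβ⟩ := ih V (fun v hv => (hVmem v hv).2) (by
    intro v hv w hw
    obtain ⟨x, hx⟩ := hint _ (hVmem v hv).1 _ (hVmem w hw).1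
    refine ⟨x, ?_⟩
    simpa using hx) (by rw [hVc]; exact hc)
  refine ⟨α, β + c * α ^ (k + 1), ?_⟩
  by_contra hcon
  push Not at hcon
  obtain ⟨g, hg, hgne⟩ := hcon
  have := star_bound k V (fun v hv => (hVmem v hv).2) α β hαβ (g - C c * X ^ (k + 1))
    (by
      intro h
      apply hgne
      simp at h
      linear_combination h)
    (by
      intro v hv
      obtain ⟨x, hx⟩ := hint _ hg _ (hVmem v hv).1
      refine ⟨x, ?_⟩
      simp at hx ⊢
      linear_combination hx)
  rw [hVc, ← hq, Nat.sub_mul, one_mul, mul_comm q, ← hqk] at this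
  omega
end step
end IFam

theorem stmt12 (F : Type*) [Field F] [Fintype F]
    (hodd : Odd (Fintype.card F) → 9 < Fintype.card F)
    (heven : Even (Fintype.card F) → 2 < Fintype.card F)
    (k : ℕ) (hk : 1 < k)
    (U : Finset (Polynomial F)) (hdeg : ∀ f ∈ U, f.natDegree ≤ k)
    (hint : ∀ f ∈ U, ∀ g ∈ U, ∃ x : F, f.eval x = g.eval x)
    (hU : Fintype.card F ^ k - Fintype.card F ^ (k - 1) < U.card) :
    ∃ α β : F, ∀ g ∈ U, g.eval α = β := by
  classical
  induction k, hk using Nat.le_induction generalizing U with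
  | base =>
    obtain ⟨p, hp⟩ := CharP.exists F
    obtain ⟨n, hprime, hcard⟩ := FiniteField.card F p
    haveI : Fact p.Prime := ⟨hprime⟩
    have hq4 : 4 ≤ p ^ (n : ℕ) := by
      rw [hcard] at hodd heven
      rcases Nat.even_or_odd (p ^ (n : ℕ)) with h | h
      · have h1 := heven h
        obtain ⟨r, hr⟩ := h
        omega
      · have := hodd h
        omega
    refine IFam.base_two p n hcard hq4 ?_ U hdeg hint (by simpa using hU)
    intro hp2
    rw [← hcard]
    apply hodd
    rw [hcard]
    exact (hprime.odd_of_ne_two hp2).pow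
  | succ k hk ih =>
    exact IFam.ind_step k (by omega) (fun U h1 h2 h3 => ih U h1 h2 h3) U hdeg hint (by simpa using hU)
end

section
/- Let q = p^n > 9 be odd and let U be an intersecting family of polynomials over F_q of degree at most 2. For b ∈ F_q let C_b = {c ∈ F_q : there exists a ∈ F_q with a + bx + cx^2 ∈ U}, and let doM = {b ∈ F_q : |C_b| > q − √q/2 + 1/2}. Then there exist functions s, t : doM → F_q and h : doM → {0, 1, …, n−1} such that for every b ∈ doM and every c ∈ C_b, the (unique) constant term a of the element a + bx + cx^2 of U equals s(b)·c^{p^{h(b)}} + t(b), and moreover −s(b) is a square in F_q. -/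
open Polynomial


theorem aux_pth_root {F : Type*} [Field F] [Fintype F] (p : ℕ) [Fact p.Prime] [CharP F p]
    (f : F[X]) (hf : derivative f = 0) : ∃ g : F[X], f = g ^ p := by
  have hp : p ≠ 0 := (Fact.out : p.Prime).ne_zero
  refine ⟨(contract p f).map ((frobeniusEquiv F p).symm : F →+* F), ?_⟩
  rw [← map_frobenius_expand, ← map_expand, expand_contract p hf hp, Polynomial.map_map]
  conv_lhs => rw [← Polynomial.map_id (p := f)]
  congr 1
  ext x
  simp

theorem aux_decomp {F : Type*} [Field F] [Fintype F] (p : ℕ) [Fact p.Prime] [CharP F p]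
    (N : ℕ) : ∀ R S : F[X], R.natDegree + S.natDegree ≤ N → IsCoprime R S →
      0 < R.natDegree + S.natDegree →
      ∃ (j : ℕ) (R1 S1 : F[X]), R = R1 ^ p ^ j ∧ S = S1 ^ p ^ j ∧ wronskian R1 S1 ≠ 0 := by
  have hp : 1 < p := (Fact.out : p.Prime).one_lt
  induction N with
  | zero => intro R S h1 _ h2; omega
  | succ N ih =>
    intro R S h1 hc h2
    by_cases hw : wronskian R S = 0
    · obtain ⟨hR, hS⟩ := hc.wronskian_eq_zero_iff.mp hw
      obtain ⟨R0, rfl⟩ := aux_pth_root p R hR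
      obtain ⟨S0, rfl⟩ := aux_pth_root p S hS
      rw [IsCoprime.pow_iff (by omega) (by omega)] at hc
      rw [natDegree_pow, natDegree_pow, ← mul_add] at h1 h2
      have h3 : 0 < R0.natDegree + S0.natDegree := Nat.pos_of_mul_pos_left h2
      obtain ⟨j, R1, S1, e1, e2, e3⟩ := ih R0 S0 (by nlinarith) hc h3
      refine ⟨j + 1, R1, S1, ?_, ?_, e3⟩
      · rw [pow_succ p j, pow_mul, ← e1]
      · rw [pow_succ p j, pow_mul, ← e2]
    · exact ⟨0, R, S, by simp, by simp, hw⟩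

theorem aux_core {F : Type*} [Field F] [Fintype F] (p n : ℕ) [Fact p.Prime] [CharP F p]
    (hp2 : Odd p) (k : ℕ) (hk : 4 * k * (k + 1) < p ^ n) (e : ℕ) (he : 2 * e + 1 = p ^ n)
    (v R S E : F[X]) (hv : v.natDegree = e) (hE : E ≠ 0) (hE' : E.natDegree ≤ k)
    (hR : R.natDegree + 1 ≤ k) (hS : S.natDegree ≤ k) (hc : IsCoprime R S)
    (h : E * v ^ 2 = X ^ p ^ n * R + S) (hv0 : v ≠ 0) : R.natDegree + S.natDegree = 0 := by
  by_contra hne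
  obtain ⟨j, R1, S1, rfl, rfl, hw⟩ := aux_decomp p _ R S le_rfl hc (by omega)
  rw [natDegree_pow] at hR hS hne
  rw [natDegree_pow] at hne
  set Q := p ^ j with hQ
  have hp : 1 < p := (Fact.out : p.Prime).one_lt
  have hQ0 : 0 < Q := by positivity
  have hQk : Q ≤ k := by
    rcases Nat.eq_zero_or_pos R1.natDegree with h0 | h0
    · have : 0 < S1.natDegree := by
        rcases Nat.eq_zero_or_pos S1.natDegree with h1 | h1
        · simp [h0, h1] at hne
        · exact h1
      nlinarith
    · nlinarith
  have hjn : j < n := by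
    have : Q < p ^ n := by nlinarith
    exact (Nat.pow_lt_pow_iff_right hp).mp this
  obtain ⟨d, rfl⟩ : ∃ d, n = j + (d + 1) := ⟨n - j - 1, by omega⟩
  have hQodd : Odd Q := hp2.pow
  set T : F[X] := X ^ p ^ (d + 1) * R1 + S1 with hT
  have hTQ : E * v ^ 2 = T ^ Q := by
    rw [h, hT, hQ, add_pow_char_pow, mul_pow, ← pow_mul, ← pow_add, add_comm (d+1) j]
  have hT0 : T ≠ 0 := by
    intro h0
    rw [h0, zero_pow hQ0.ne'] at hTQ
    exact (mul_ne_zero hE (pow_ne_zero 2 hv0)) hTQ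
  obtain ⟨u, hu⟩ := hQodd
  obtain ⟨M, hM⟩ : T ^ u ∣ E * v := by
    rw [← UniqueFactorizationMonoid.pow_dvd_pow_iff_dvd (two_ne_zero)]
    refine ⟨T * E, ?_⟩
    calc (E * v) ^ 2 = E * (E * v ^ 2) := by ring
      _ = E * T ^ (2 * u + 1) := by rw [hTQ, hu]
      _ = _ := by ring
  have hTE : T * E = M ^ 2 := by
    have h1 : (T ^ u) ^ 2 ≠ 0 := pow_ne_zero _ (pow_ne_zero _ hT0)
    apply mul_left_cancel₀ h1
    calc (T ^ u) ^ 2 * (T * E) = E * T ^ (2 * u + 1) := by ring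
      _ = E * (E * v ^ 2) := by rw [hTQ, hu]
      _ = (E * v) ^ 2 := by ring
      _ = _ := by rw [hM]; ring
  have hdT : derivative T = X ^ p ^ (d + 1) * derivative R1 + derivative S1 := by
    rw [hT]
    simp [derivative_mul, derivative_X_pow]
  have hW : wronskian R1 S1 = R1 * derivative T - T * derivative R1 := by
    rw [hdT, hT, wronskian]; ring
  have hd2 : derivative T * E + T * derivative E = 2 * M * derivative M := by
    have := congrArg derivative hTE
    rw [derivative_mul, sq, derivative_mul] at this
    rw [this]; ring
  have hdvd : M ∣ E ^ 2 * wronskian R1 S1 := by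
    refine ⟨2 * derivative M * E * R1 - M * derivative E * R1 - E * M * derivative R1, ?_⟩
    rw [hW]
    linear_combination (E * R1) * hd2 - (derivative E * R1 + E * derivative R1) * hTE
  have hdegM := natDegree_le_of_dvd hdvd (mul_ne_zero (pow_ne_zero _ hE) hw)
  rw [natDegree_mul (pow_ne_zero _ hE) hw, natDegree_pow] at hdegM
  have hwr := natDegree_wronskian_lt_add hw
  have h2M := congrArg natDegree hTE
  rw [natDegree_mul hT0 hE, natDegree_pow] at h2M
  have hTd := congrArg natDegree hTQ
  rw [natDegree_mul hE (pow_ne_zero _ hv0), natDegree_pow, natDegree_pow, hv] at hTd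
  have h3 : T.natDegree ≤ 3 * E.natDegree + 2 * (R1.natDegree + S1.natDegree) := by omega
  have h4 := Nat.mul_le_mul_left Q h3
  have h5 : Q * E.natDegree ≤ k * k := Nat.mul_le_mul hQk hE'
  rw [← hTd] at h4
  nlinarith

theorem aux_prod {F : Type*} [Field F] [Fintype F] :
    (X ^ Fintype.card F - X : F[X]) = ∏ c : F, (X - C c) := by
  have hm : (X ^ Fintype.card F - X : F[X]).Monic := by
    apply monic_X_pow_sub
    rw [degree_X]; exact_mod_cast Fintype.one_lt_card
  have hd := FiniteField.X_pow_card_sub_X_natDegree_eq F (p := Fintype.card F) Fintype.one_lt_card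
  have := prod_multiset_X_sub_C_of_monic_of_roots_card_eq hm (by
    rw [FiniteField.roots_X_pow_card_sub_X, hd]; rfl)
  rw [FiniteField.roots_X_pow_card_sub_X] at this
  exact this.symm

theorem aux_L {F : Type*} [Field F] [Fintype F] [DecidableEq F] (p n : ℕ) [Fact p.Prime] [CharP F p]
    (hcard : Fintype.card F = p ^ n)
    (hp2 : Odd p) (k : ℕ) (hk : 4 * k * (k + 1) < p ^ n) (e : ℕ) (he : 2 * e + 1 = p ^ n)
    (he0 : 0 < e)
    (S : Finset F) (hS : S.card + k = p ^ n)
    (v : F[X]) (hv : v.natDegree = e) (h1 : ∀ y ∈ S, v.eval y ^ 2 = 1) :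
    ∃ z : F, v = (X - C z) ^ e ∨ v = - (X - C z) ^ e := by
  have hv0 : v ≠ 0 := by rintro rfl; simp at hv; omega
  set W : F[X] := ∏ c ∈ S, (X - C c) with hW
  set E : F[X] := ∏ c ∈ Sᶜ, (X - C c) with hEdef
  have hWE : W * E = X ^ p ^ n - X := by
    rw [hW, hEdef, Finset.prod_mul_prod_compl, ← hcard]
    exact aux_prod.symm
  have hWd : W.natDegree = S.card := by
    rw [hW, natDegree_prod_of_monic _ _ (fun c _ => monic_X_sub_C c)]; simp
  have hEd : E.natDegree = k := by
    rw [hEdef, natDegree_prod_of_monic _ _ (fun c _ => monic_X_sub_C c)]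
    simp [Finset.card_compl, hcard]; omega
  have hE0 : E ≠ 0 := (monic_prod_of_monic _ _ (fun c _ => monic_X_sub_C c)).ne_zero
  have hW0 : W ≠ 0 := (monic_prod_of_monic _ _ (fun c _ => monic_X_sub_C c)).ne_zero
  obtain ⟨r, hr⟩ : W ∣ v ^ 2 - 1 := by
    rw [hW]
    apply Finset.prod_dvd_of_coprime
    · intro a _ b _ hab
      exact isCoprime_X_sub_C_of_isUnit_sub (sub_ne_zero.mpr hab).isUnit
    · intro a ha
      rw [dvd_iff_isRoot]
      simp [h1 a ha]
  have hv2 : (v ^ 2 - 1).natDegree = 2 * e := by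
    rw [← C_1, natDegree_sub_C, natDegree_pow, hv]
  have hr0 : r ≠ 0 := by
    rintro rfl
    rw [mul_zero] at hr
    rw [hr] at hv2; simp at hv2; omega
  have hrd : r.natDegree + 1 = k := by
    rw [hr, natDegree_mul hW0 hr0, hWd] at hv2
    omega
  have hmain : E * v ^ 2 = X ^ p ^ n * r + (E - X * r) := by
    linear_combination E * hr + r * hWE
  obtain ⟨R, hR⟩ := EuclideanDomain.gcd_dvd_left r (E - X * r)
  obtain ⟨S1, hS1⟩ := EuclideanDomain.gcd_dvd_right r (E - X * r)
  have hcop : IsCoprime R S1 := by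
    have hb := EuclideanDomain.gcd_eq_gcd_ab r (E - X * r)
    have hg0 : EuclideanDomain.gcd r (E - X * r) ≠ 0 := by
      intro h0; rw [h0, zero_mul] at hR; exact hr0 hR
    refine ⟨EuclideanDomain.gcdA r (E - X * r), EuclideanDomain.gcdB r (E - X * r), ?_⟩
    apply mul_left_cancel₀ hg0
    linear_combination -hb - EuclideanDomain.gcdA r (E - X * r) * hR
      - EuclideanDomain.gcdB r (E - X * r) * hS1
  generalize EuclideanDomain.gcd r (E - X * r) = D at hR hS1
  have hD0 : D ≠ 0 := by rintro rfl; simp at hR; exact hr0 hR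
  have hR0 : R ≠ 0 := by rintro rfl; simp at hR; exact hr0 hR
  have hE1 : E = D * (S1 + X * R) := by linear_combination hS1 + X * hR
  have hE10 : S1 + X * R ≠ 0 := by
    intro h0; rw [h0, mul_zero] at hE1; exact hE0 hE1
  have hE1v : (S1 + X * R) * v ^ 2 = X ^ p ^ n * R + S1 := by
    apply mul_left_cancel₀ hD0
    linear_combination hmain - v ^ 2 * hE1 + X ^ p ^ n * hR + hS1
  have hRk : R.natDegree + 1 ≤ k := by
    have := congrArg natDegree hR
    rw [natDegree_mul hD0 hR0] at this; omega
  have hE1k : (S1 + X * R).natDegree ≤ k := by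
    have := congrArg natDegree hE1
    rw [natDegree_mul hD0 hE10] at this; omega
  have hS1k : S1.natDegree ≤ k := by
    have : S1 = (S1 + X * R) - X * R := by ring
    rw [this]
    refine (natDegree_sub_le _ _).trans (max_le hE1k ?_)
    rw [natDegree_X_mul hR0]; exact hRk
  have h0 := aux_core p n hp2 k hk e he v R S1 _ hv hE10 hE1k hRk hS1k hcop hE1v hv0
  obtain ⟨c, rfl⟩ : ∃ c, R = C c := ⟨_, eq_C_of_natDegree_eq_zero (by omega)⟩
  obtain ⟨d, rfl⟩ : ∃ c, S1 = C c := ⟨_, eq_C_of_natDegree_eq_zero (by omega)⟩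
  have hc0 : c ≠ 0 := by rintro rfl; simp at hR0
  have hv3 : v ^ 2 = ((X - C (-(d / c))) ^ e) ^ 2 := by
    have h5 : (X - C (-(d / c))) * C c = C d + X * C c := by
      rw [sub_mul, ← C_mul, neg_mul, div_mul_cancel₀ _ hc0, C_neg]; ring
    have h6 : (X - C (-(d / c))) ^ (p ^ n) = X ^ p ^ n - C (-(d / c)) := by
      rw [sub_pow_char_pow, ← C_pow, ← hcard, FiniteField.pow_card]
    have h7 : (X - C (-(d / c))) * C c ≠ 0 := by rw [h5]; exact hE10
    apply mul_left_cancel₀ h7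
    rw [h5, hE1v]
    have h8 : (C d + X * C c) * ((X - C (-(d / c))) ^ e) ^ 2 = C c * (X - C (-(d / c))) ^ (p ^ n) := by
      rw [← h5, ← he]; ring
    rw [h8, h6, mul_sub, ← C_mul, mul_neg, mul_div_cancel₀ _ hc0, C_neg]; ring
  exact ⟨_, sq_eq_sq_iff_eq_or_eq_neg.mp hv3⟩

theorem aux_functional {F : Type*} [Field F] [DecidableEq F] (S : Finset F) (φ : F[X] →ₗ[F] F) :
    ∃ w : F → F, ∀ f : F[X], f.degree < S.card → φ f = ∑ x ∈ S, w x * f.eval x := by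
  refine ⟨fun x => φ (Lagrange.basis S id x), fun f hf => ?_⟩
  conv_lhs => rw [Lagrange.eq_interpolate (s := S) (v := id) (Set.injOn_id _) hf]
  rw [Lagrange.interpolate_apply, map_sum]
  refine Finset.sum_congr rfl fun x _ => ?_
  rw [← smul_eq_C_mul, map_smul, smul_eq_mul, mul_comm]
  rfl

theorem aux_degree_pow {F : Type*} [Field F] (x : F) (e N : ℕ) (h : e < N) :
    ((X - C x) ^ e : F[X]).degree < N := by
  rw [degree_pow, degree_X_sub_C]
  simpa using h

theorem aux_sq_pow {F : Type*} [Field F] [Fintype F] (e : ℕ) (he : 2 * e + 1 = Fintype.card F)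
    (x : F) (hx : x ≠ 0) : (x ^ e) ^ 2 = 1 := by
  rw [← pow_mul, ← FiniteField.pow_card_sub_one_eq_one x hx]
  congr 1; omega

theorem aux_point {F : Type*} [Field F] [Fintype F] [DecidableEq F] (p n : ℕ) [Fact p.Prime]
    [CharP F p] (hcard : Fintype.card F = p ^ n)
    (hp2 : Odd p) (k : ℕ) (hk : 4 * k * (k + 1) < p ^ n) (e : ℕ) (he : 2 * e + 1 = p ^ n)
    (he0 : 0 < e) (S : Finset F) (hS : S.card + k = p ^ n) (g : F → F)
    (hinj : Set.InjOn g S)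
    (hg : ∀ x ∈ S, ∀ y ∈ S, (g x - g y) ^ e = (x - y) ^ e) (x0 : F) :
    ∃ (z : F) (w : F → F), (∀ y, (x0 - y) ^ e = ∑ x ∈ S, w x * (x - y) ^ e) ∧
      (∀ t, (z - t) ^ e = ∑ x ∈ S, w x * (g x - t) ^ e) := by
  by_cases hx0 : x0 ∈ S
  · refine ⟨g x0, fun x => if x = x0 then 1 else 0, fun y => ?_, fun t => ?_⟩ <;>
    simp [Finset.sum_ite_eq', hx0]
  obtain ⟨w, hw⟩ := aux_functional S (Polynomial.leval x0)
  have heS : e < S.card := by nlinarith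
  have hw1 : ∀ y, (x0 - y) ^ e = ∑ x ∈ S, w x * (x - y) ^ e := by
    intro y
    have := hw ((X - C y) ^ e) (aux_degree_pow y e _ heS)
    simpa [leval_apply] using this
  have hw2 : ∑ x ∈ S, w x = 1 := by
    have := hw 1 (by rw [degree_one]; exact_mod_cast (by omega : 0 < S.card))
    simpa [leval_apply] using this.symm
  set v : F[X] := ∑ x ∈ S, C (w x * (-1) ^ e) * (X - C (g x)) ^ e with hv
  have hveval : ∀ t, v.eval t = ∑ x ∈ S, w x * (g x - t) ^ e := by
    intro t
    rw [hv, eval_finsetSum]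
    refine Finset.sum_congr rfl fun x _ => ?_
    simp only [eval_mul, eval_C, eval_pow, eval_sub, eval_X]
    rw [mul_assoc, ← mul_pow]; ring
  have hvle : v.natDegree ≤ e := by
    apply natDegree_sum_le_of_forall_le
    intro x _
    refine (natDegree_C_mul_le _ _).trans ?_
    rw [natDegree_pow, natDegree_X_sub_C, mul_one]
  have hvc : v.coeff e = (-1) ^ e := by
    rw [hv, finsetSum_coeff]
    have : ∀ x ∈ S, (C (w x * (-1) ^ e) * (X - C (g x)) ^ e).coeff e = w x * (-1) ^ e := by
      intro x _
      rw [coeff_C_mul]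
      have h1 := ((monic_X_sub_C (g x)).pow e).coeff_natDegree
      rw [natDegree_pow, natDegree_X_sub_C, mul_one] at h1
      rw [h1, mul_one]
    rw [Finset.sum_congr rfl this, ← Finset.sum_mul, hw2, one_mul]
  have hvd : v.natDegree = e := by
    apply le_antisymm hvle
    apply le_natDegree_of_ne_zero
    rw [hvc]; exact pow_ne_zero _ (by simp)
  have hval : ∀ y ∈ S, v.eval (g y) = (x0 - y) ^ e := by
    intro y hy
    rw [hveval, hw1]
    exact Finset.sum_congr rfl fun x hx => by rw [hg x hx y hy]
  obtain ⟨z, hz⟩ := aux_L p n hcard hp2 k hk e he he0 (S.image g)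
    (by rw [Finset.card_image_of_injOn hinj, hS]) v hvd (by
      intro y hy
      obtain ⟨y, hyS, rfl⟩ := Finset.mem_image.mp hy
      rw [hval y hyS]
      apply aux_sq_pow e (by rw [he, hcard])
      intro h
      rw [sub_eq_zero] at h
      exact hx0 (h ▸ hyS))
  have h1 := ((monic_X_sub_C z).pow e).coeff_natDegree
  rw [natDegree_pow, natDegree_X_sub_C, mul_one] at h1
  have h2 : (2 : F) ≠ 0 := by
    apply Ring.two_ne_zero
    rw [ringChar.eq F p]
    rintro rfl; exact absurd hp2 (by decide)
  -- up to sign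
  have hsgn : v = C ((-1) ^ e) * (X - C z) ^ e := by
    rcases hz with hz | hz
    · rw [hz, h1] at hvc
      rw [← hvc, hz]; simp
    · rw [hz, coeff_neg, h1] at hvc
      rw [← hvc, hz]; simp
  refine ⟨z, w, hw1, fun t => ?_⟩
  rw [← hveval, hsgn]
  simp only [eval_mul, eval_C, eval_pow, eval_sub, eval_X]
  rw [← mul_pow]; ring

theorem aux_extend {F : Type*} [Field F] [Fintype F] [DecidableEq F] (p n : ℕ) [Fact p.Prime]
    [CharP F p] (hcard : Fintype.card F = p ^ n)
    (hp2 : Odd p) (k : ℕ) (hk : 4 * k * (k + 1) < p ^ n) (e : ℕ) (he : 2 * e + 1 = p ^ n)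
    (he0 : 0 < e) (S : Finset F) (hS : S.card + k = p ^ n) (g : F → F)
    (hinj : Set.InjOn g S)
    (hg : ∀ x ∈ S, ∀ y ∈ S, (g x - g y) ^ e = (x - y) ^ e) :
    ∃ G : F → F, (∀ x ∈ S, G x = g x) ∧ ∀ x y, (G x - G y) ^ e = (x - y) ^ e := by
  choose G w h1 h2 using aux_point p n hcard hp2 k hk e he he0 S hS g hinj hg
  have h3 : ∀ x0, ∀ y ∈ S, (G x0 - g y) ^ e = (x0 - y) ^ e := by
    intro x0 y hy
    rw [h2 x0, h1 x0]
    exact Finset.sum_congr rfl fun x hx => by rw [hg x hx y hy]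
  refine ⟨G, fun x hx => ?_, fun x y => ?_⟩
  · have := h3 x x hx
    rw [sub_self, zero_pow he0.ne'] at this
    exact sub_eq_zero.mp (pow_eq_zero_iff he0.ne' |>.mp this)
  · rw [h2 x, h1 x]
    refine Finset.sum_congr rfl fun c hc => ?_
    rw [← neg_sub, neg_pow, h3 y c hc, ← neg_pow, neg_sub]

theorem aux_char_sum {F : Type*} [Field F] [Fintype F] [DecidableEq F] (hF : ringChar F ≠ 2)
    (d : F) (hd : d ≠ 0) : ∑ x : F, quadraticChar F x * quadraticChar F (x + d) = -1 := by
  have h1 : ∑ x : F, quadraticChar F x * quadraticChar F (x + d)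
      = ∑ u ∈ Finset.univ.erase (1 : F), quadraticChar F u := by
    rw [← Finset.sum_erase (s := Finset.univ) (a := (0 : F)) (by simp)]
    refine Finset.sum_bij' (fun x _ => (x + d) / x) (fun u _ => d / (u - 1)) ?_ ?_ ?_ ?_ ?_
    · intro x hx
      have hx : x ≠ 0 := by simpa using hx
      simp only [Finset.mem_erase, Finset.mem_univ, and_true]
      rw [Ne, div_eq_one_iff_eq hx]; simpa using hd
    · intro u hu
      have hu : u ≠ 1 := by simpa using hu
      simp [hd, sub_ne_zero.mpr hu]
    · intro x hx
      have hx : x ≠ 0 := by simpa using hx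
      field_simp
      simp [hd]
    · intro u hu
      have hu : u ≠ 1 := by simpa using hu
      have := sub_ne_zero.mpr hu
      field_simp
      ring
    · intro x hx
      have hx : x ≠ 0 := by simpa using hx
      have h2 : x + d = x * ((x + d) / x) := by field_simp
      conv_lhs => rw [h2, map_mul, ← mul_assoc, ← sq, quadraticChar_sq_one hx, one_mul]
  rw [h1]
  have h2 := Finset.sum_erase_add Finset.univ (quadraticChar F) (Finset.mem_univ 1)
  rw [quadraticChar_sum_zero hF, map_one] at h2
  linarith

theorem aux_second_moment {F : Type*} [Field F] [Fintype F] [DecidableEq F] (hF : ringChar F ≠ 2)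
    (A : Finset F) : ∑ x : F, (∑ a ∈ A, quadraticChar F (x - a)) ^ 2
      = (A.card : ℤ) * Fintype.card F - (A.card : ℤ) ^ 2 := by
  have h1 : ∀ a b : F, ∑ x : F, quadraticChar F (x - a) * quadraticChar F (x - b)
      = (if a = b then (Fintype.card F : ℤ) else 0) - 1 := by
    intro a b
    rw [← Equiv.sum_comp (Equiv.addRight a)]
    simp only [Equiv.coe_addRight, add_sub_cancel_right]
    split_ifs with hab
    · subst hab
      simp only [add_sub_cancel_right]
      rw [← Finset.sum_erase (s := Finset.univ) (a := (0 : F)) (by simp)]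
      rw [Finset.sum_congr rfl (g := fun _ => (1 : ℤ))]
      · simp [Finset.card_erase_of_mem, Finset.card_univ, Nat.cast_sub Fintype.card_pos]
      · intro x hx
        have hx : x ≠ 0 := by simpa using hx
        rw [← sq, quadraticChar_sq_one hx]
    · have := aux_char_sum hF (a - b) (sub_ne_zero.mpr hab)
      simp only [add_sub_assoc, this, zero_sub]
  simp only [sq, Finset.sum_mul_sum]
  rw [Finset.sum_comm]
  have : ∀ a ∈ A, ∑ x : F, ∑ b ∈ A, quadraticChar F (x - a) * quadraticChar F (x - b)
      = (Fintype.card F : ℤ) - A.card := by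
    intro a ha
    rw [Finset.sum_comm]
    simp only [h1, Finset.sum_sub_distrib, Finset.sum_ite_eq, ha, if_true]
    simp
  rw [Finset.sum_congr rfl this]
  simp
  try ring

theorem aux_const_or_inj {F : Type*} [Field F] [Fintype F] [DecidableEq F] (hF : ringChar F ≠ 2)
    (S : Finset F) (hS : Fintype.card F + 2 < 2 * S.card) (g : F → F)
    (hg : ∀ x ∈ S, ∀ y ∈ S, IsSquare ((g x - g y) * (x - y))) :
    (∃ t, ∀ x ∈ S, g x = t) ∨ Set.InjOn g S := by
  by_contra hcon
  push Not at hcon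
  obtain ⟨hc, hi⟩ := hcon
  simp only [Set.InjOn] at hi
  push Not at hi
  obtain ⟨a1, ha1, a2, ha2, h12, hne⟩ := hi
  obtain ⟨b0, hb0, hb0'⟩ := hc (g a1)
  set A := S.filter (fun x => g x = g a1) with hA
  set B := S.filter (fun x => ¬ g x = g a1) with hB
  have hcard : A.card + B.card = S.card := Finset.card_filter_add_card_filter_not _
  have hA2 : 2 ≤ A.card := by
    have : ({a1, a2} : Finset F) ⊆ A := by
      intro x hx
      simp only [Finset.mem_insert, Finset.mem_singleton] at hx
      simp only [hA, Finset.mem_filter]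
      rcases hx with rfl | rfl
      · exact ⟨ha1, rfl⟩
      · exact ⟨ha2, h12.symm⟩
    have h := Finset.card_le_card this
    rwa [Finset.card_pair hne] at h
  have hB1 : 1 ≤ B.card := Finset.card_pos.mpr ⟨b0, by simp [hB, hb0, hb0']⟩
  have hsum := aux_second_moment hF A
  have hlow : (B.card : ℤ) * (A.card : ℤ) ^ 2 ≤
      ∑ x : F, (∑ a ∈ A, quadraticChar F (x - a)) ^ 2 := by
    calc (B.card : ℤ) * (A.card : ℤ) ^ 2 = ∑ x ∈ B, (A.card : ℤ) ^ 2 := by simp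
      _ = ∑ x ∈ B, (∑ a ∈ A, quadraticChar F (x - a)) ^ 2 := by
        refine Finset.sum_congr rfl fun b hb => ?_
        simp only [hB, Finset.mem_filter] at hb
        have h3 : ∀ a ∈ A, quadraticChar F (b - a) = quadraticChar F (g b - g a1) := by
          intro a ha
          simp only [hA, Finset.mem_filter] at ha
          have hn1 : g b - g a1 ≠ 0 := sub_ne_zero.mpr hb.2
          have hn2 : b - a ≠ 0 := by
            intro h; rw [sub_eq_zero] at h; rw [h] at hb; exact hb.2 ha.2
          have h4 := hg b hb.1 a ha.1
          rw [ha.2, ← quadraticChar_one_iff_isSquare (mul_ne_zero hn1 hn2), map_mul] at h4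
          have h5 := quadraticChar_sq_one hn1
          calc quadraticChar F (b - a) = quadraticChar F (g b - g a1) ^ 2 * quadraticChar F (b - a) := by
                rw [h5, one_mul]
            _ = quadraticChar F (g b - g a1) *
                (quadraticChar F (g b - g a1) * quadraticChar F (b - a)) := by ring
            _ = _ := by rw [h4, mul_one]
        rw [Finset.sum_congr rfl h3, Finset.sum_const, nsmul_eq_mul, mul_pow,
          quadraticChar_sq_one (sub_ne_zero.mpr hb.2), mul_one]
      _ ≤ _ := Finset.sum_le_sum_of_subset_of_nonneg (Finset.subset_univ _)
          (fun _ _ _ => sq_nonneg _)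
  rw [hsum] at hlow
  have hAz : (2 : ℤ) ≤ A.card := by exact_mod_cast hA2
  have hBz : (1 : ℤ) ≤ B.card := by exact_mod_cast hB1
  have hSz : (Fintype.card F : ℤ) + 2 < 2 * (A.card + B.card) := by
    exact_mod_cast (by omega : Fintype.card F + 2 < 2 * (A.card + B.card))
  have h6 : (B.card : ℤ) * A.card + A.card ≤ Fintype.card F := by
    have : (A.card : ℤ) * (B.card * A.card + A.card) ≤ A.card * Fintype.card F := by nlinarith
    exact le_of_mul_le_mul_left this (by linarith)
  nlinarith [mul_nonneg (sub_nonneg.mpr hAz) (sub_nonneg.mpr hBz)]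

theorem aux_choose_step (p : ℕ) [Fact p.Prime] (m d r s : ℕ) (hm : 2 * m + 1 = p) (hr : r ≤ m)
    (h : ¬ p ∣ d.choose s) : ¬ p ∣ (m + p * d).choose (r + p * s) := by
  have hp : p.Prime := Fact.out
  have h1 := Choose.choose_modEq_choose_mod_mul_choose_div_nat (p := p) (n := m + p * d)
    (k := r + p * s)
  rw [Nat.add_mul_mod_self_left, Nat.add_mul_mod_self_left, Nat.add_mul_div_left _ _ hp.pos,
    Nat.add_mul_div_left _ _ hp.pos, Nat.mod_eq_of_lt (by omega : m < p),
    Nat.mod_eq_of_lt (by omega : r < p), Nat.div_eq_of_lt (by omega : m < p),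
    Nat.div_eq_of_lt (by omega : r < p), zero_add, zero_add] at h1
  rw [h1.dvd_iff dvd_rfl, hp.dvd_mul]
  rintro (h2 | h2)
  · have h3 : m.choose r ∣ m.factorial := by
      rw [← Nat.choose_mul_factorial_mul_factorial hr, mul_assoc]
      exact Dvd.intro _ rfl
    have := (hp.dvd_factorial).mp (h2.trans h3)
    omega
  · exact h h2

theorem aux_half (p : ℕ) (m : ℕ) (hm : 2 * m + 1 = p) (n e : ℕ) (he : 2 * e + 1 = p ^ (n + 1)) :
    ∃ d, e = m + p * d ∧ 2 * d + 1 = p ^ n := by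
  have hodd : Odd (p ^ n) := Odd.pow ⟨m, hm.symm⟩
  obtain ⟨d, hd⟩ := hodd
  refine ⟨d, ?_, hd.symm⟩
  rw [pow_succ, hd] at he
  nlinarith

theorem aux_choose1 (p : ℕ) [Fact p.Prime] (m : ℕ) (hm : 2 * m + 1 = p) (n e : ℕ)
    (he : 2 * e + 1 = p ^ (n + 1)) (j : ℕ) (hj : j ≤ m) : ¬ p ∣ e.choose j := by
  obtain ⟨d, rfl, hd⟩ := aux_half p m hm n e he
  have := aux_choose_step p m d j 0 hm hj
    (by rw [Nat.choose_zero_right, Nat.dvd_one]; exact (Fact.out : p.Prime).ne_one)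
  simpa using this

theorem aux_choose2 (p : ℕ) [Fact p.Prime] (m : ℕ) (hm : 2 * m + 1 = p) (i : ℕ) : ∀ (n e : ℕ)
    (_ : 2 * e + 1 = p ^ (n + 1)) (_ : i < n + 1), ¬ p ∣ e.choose (m * p ^ i) := by
  induction i with
  | zero => intro n e he _; simpa using aux_choose1 p m hm n e he m le_rfl
  | succ i ih =>
    intro n e he hi
    obtain ⟨d, rfl, hd⟩ := aux_half p m hm n e he
    obtain ⟨n, rfl⟩ : ∃ k, n = k + 1 := ⟨n - 1, by omega⟩
    have := aux_choose_step p m d 0 (m * p ^ i) hm (Nat.zero_le _) (ih n d hd (by omega))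
    rw [zero_add] at this
    rwa [show m * p ^ (i + 1) = p * (m * p ^ i) by ring]

theorem aux_choose3 (p : ℕ) [Fact p.Prime] (m : ℕ) (hm : 2 * m + 1 = p) (i : ℕ) (n e : ℕ)
    (he : 2 * e + 1 = p ^ n) (hi : i < n) (hi0 : 0 < i) : ¬ p ∣ e.choose (m + m * p ^ i) := by
  obtain ⟨n, rfl⟩ : ∃ k, n = k + 1 := ⟨n - 1, by omega⟩
  obtain ⟨d, rfl, hd⟩ := aux_half p m hm n e he
  obtain ⟨n, rfl⟩ : ∃ k, n = k + 1 := ⟨n - 1, by omega⟩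
  obtain ⟨i, rfl⟩ : ∃ k, i = k + 1 := ⟨i - 1, by omega⟩
  have := aux_choose_step p m d m (m * p ^ i) hm le_rfl (aux_choose2 p m hm i n d hd (by omega))
  rwa [show m * p ^ (i + 1) = p * (m * p ^ i) by ring]

theorem aux_geom (p m : ℕ) (hm : 2 * m + 1 = p) (n : ℕ) :
    2 * (∑ j : Fin n, p ^ (j : ℕ) * m) + 1 = p ^ n := by
  induction n with
  | zero => simp
  | succ n ih =>
    rw [Fin.sum_univ_castSucc, mul_add, add_right_comm]
    simp only [Fin.val_castSucc, Fin.val_last]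
    rw [ih, pow_succ, ← hm]; ring

/-- Evaluation of a polynomial in `n` variables at the Frobenius conjugates of `x`. -/
noncomputable def aux_ev {F : Type*} [Field F] (p n : ℕ) (x : F) : MvPolynomial (Fin n) F →+* F :=
  MvPolynomial.eval (fun i : Fin n => x ^ p ^ (i : ℕ))

theorem aux_wt_inj (p n : ℕ) (d d' : Fin n →₀ ℕ) (hd : ∀ i, d i < p) (hd' : ∀ i, d' i < p)
    (h : ∑ i, d i * p ^ (i : ℕ) = ∑ i, d' i * p ^ (i : ℕ)) : d = d' := by
  have := finFunctionFinEquiv (m := p) (n := n) |>.injective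
    (a₁ := fun i => ⟨d i, hd i⟩) (a₂ := fun i => ⟨d' i, hd' i⟩) (by
      apply Fin.ext
      rw [finFunctionFinEquiv_apply, finFunctionFinEquiv_apply]
      exact h)
  ext i
  have h2 := congrFun this i
  simpa using h2

theorem aux_wt_lt (p n : ℕ) (d : Fin n →₀ ℕ) (hd : ∀ i, d i < p) :
    ∑ i, d i * p ^ (i : ℕ) < p ^ n := by
  have := (finFunctionFinEquiv (m := p) (n := n) (fun i => ⟨d i, hd i⟩)).isLt
  rwa [finFunctionFinEquiv_apply] at this

theorem aux_ev_inj {F : Type*} [Field F] [Fintype F] [DecidableEq F] (p n : ℕ)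
    (hcard : Fintype.card F = p ^ n) (P : MvPolynomial (Fin n) F)
    (hP : ∀ i, P.degreeOf i < p) (h : ∀ x : F, aux_ev p n x P = 0) : P = 0 := by
  have hsupp : ∀ d ∈ P.support, ∀ i, d i < p := fun d hd i =>
    (MvPolynomial.monomial_le_degreeOf i hd).trans_lt (hP i)
  set u : F[X] := ∑ d ∈ P.support, C (P.coeff d) * X ^ (∑ i, d i * p ^ (i : ℕ)) with hu
  have hu0 : u = 0 := by
    apply Polynomial.eq_zero_of_degree_lt_of_eval_finset_eq_zero (s := (Finset.univ : Finset F))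
    · rw [Finset.card_univ, hcard]
      refine (degree_sum_le _ _).trans_lt ?_
      rw [Finset.sup_lt_iff (by exact WithBot.bot_lt_coe _)]
      intro d hd
      refine (degree_C_mul_X_pow_le _ _).trans_lt ?_
      exact_mod_cast aux_wt_lt p n d (hsupp d hd)
    · intro x _
      rw [← h x, aux_ev, MvPolynomial.eval_eq', hu, eval_finsetSum]
      refine Finset.sum_congr rfl fun d _ => ?_
      simp only [eval_mul, eval_C, eval_pow, eval_X]
      rw [← Finset.prod_pow_eq_pow_sum]
      congr 1
      refine Finset.prod_congr rfl fun i _ => ?_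
      rw [← pow_mul, mul_comm]
  by_contra hP0
  obtain ⟨d, hd⟩ := MvPolynomial.support_nonempty.mpr hP0
  have h1 : u.coeff (∑ i, d i * p ^ (i : ℕ)) = P.coeff d := by
    rw [hu, finsetSum_coeff, Finset.sum_eq_single d]
    · simp
    · intro d' hd' hne
      rw [coeff_C_mul_X_pow, if_neg]
      intro heq
      exact hne (aux_wt_inj p n d' d (hsupp d' hd') (hsupp d hd) heq.symm)
    · intro hn; exact absurd hd hn
  rw [hu0, coeff_zero] at h1
  exact (MvPolynomial.mem_support_iff.mp hd) h1.symm

theorem aux_rep {F : Type*} [Field F] [Fintype F] [DecidableEq F] (p n : ℕ) [Fact p.Prime]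
    [CharP F p] (hcard : Fintype.card F = p ^ n) (m : ℕ) (hm : 2 * m + 1 = p)
    (e : ℕ) (he : 2 * e + 1 = p ^ n) (he0 : 0 < e) (G : F → F)
    (hG : ∀ x y, (G x - G y) ^ e = (x - y) ^ e) (i : ℕ) (hi : i ≤ e) (hc : ¬ p ∣ e.choose i) :
    ∃ P : MvPolynomial (Fin n) F, (∀ j, P.degreeOf j ≤ m) ∧ ∀ x, aux_ev p n x P = G x ^ i := by
  have hinj : Function.Injective G := by
    intro x y hxy
    have := hG x y
    rw [hxy, sub_self, zero_pow he0.ne'] at this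
    exact sub_eq_zero.mp (pow_eq_zero_iff he0.ne' |>.mp this.symm)
  have hbij : Function.Bijective G := Finite.injective_iff_bijective.mp hinj
  have hc0 : ((e.choose i : ℕ) : F) ≠ 0 := by rwa [Ne, CharP.cast_eq_zero_iff F p]
  obtain ⟨w, hw⟩ := aux_functional (Finset.univ : Finset F) (Polynomial.lcoeff F (e - i))
  have heq : e = ∑ j : Fin n, p ^ (j : ℕ) * m := by have := aux_geom p m hm n; omega
  have h1 : ∀ x, (-G x) ^ i * (e.choose i : F) = ∑ b : F, w (G b) * (b - x) ^ e := by
    intro x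
    have h2 := hw ((X - C (G x)) ^ e) (aux_degree_pow _ _ _ (by
      rw [Finset.card_univ, hcard]; omega))
    rw [lcoeff_apply, sub_eq_add_neg, ← C_neg, coeff_X_add_C_pow, Nat.sub_sub_self hi, Nat.choose_symm hi] at h2
    rw [h2, ← Function.Bijective.sum_comp hbij]
    refine Finset.sum_congr rfl fun b _ => ?_
    rw [C_neg, ← sub_eq_add_neg]
    simp only [eval_pow, eval_sub, eval_X, eval_C, hG]
  refine ⟨MvPolynomial.C ((-1) ^ i * (e.choose i : F)⁻¹) * ∑ b : F, MvPolynomial.C (w (G b)) *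
    ∏ j : Fin n, (MvPolynomial.C (b ^ p ^ (j : ℕ)) - MvPolynomial.X j) ^ m, fun j => ?_, fun x => ?_⟩
  · refine (MvPolynomial.degreeOf_C_mul_le _ _ _).trans ?_
    refine (MvPolynomial.degreeOf_sum_le _ _ _).trans ?_
    refine Finset.sup_le fun b _ => ?_
    refine (MvPolynomial.degreeOf_C_mul_le _ _ _).trans ?_
    refine (MvPolynomial.degreeOf_prod_le _ _ _).trans ?_
    calc _ ≤ ∑ l : Fin n, if l = j then m else 0 := by
          refine Finset.sum_le_sum fun l _ => ?_
          refine (MvPolynomial.degreeOf_pow_le _ _ _).trans ?_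
          have h3 := MvPolynomial.degreeOf_sub_le j
            (MvPolynomial.C (b ^ p ^ (l : ℕ)) : MvPolynomial (Fin n) F) (MvPolynomial.X l)
          rw [MvPolynomial.degreeOf_C, MvPolynomial.degreeOf_X] at h3
          split_ifs with hlj
          · rw [if_pos hlj.symm] at h3
            rw [Nat.zero_max] at h3; nlinarith
          · rw [if_neg (Ne.symm hlj)] at h3
            rw [Nat.zero_max] at h3; rw [Nat.le_zero.mp h3, mul_zero]
      _ = m := by simp
  · have h4 : ∀ b : F, (b - x) ^ e = ∏ j : Fin n, (b ^ p ^ (j : ℕ) - x ^ p ^ (j : ℕ)) ^ m := by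
      intro b
      rw [heq, ← Finset.prod_pow_eq_pow_sum]
      refine Finset.prod_congr rfl fun j _ => ?_
      rw [pow_mul, sub_pow_char_pow]
    simp only [aux_ev, map_mul, map_sum, map_prod, map_pow, map_sub, MvPolynomial.eval_C,
      MvPolynomial.eval_X]
    simp only [← h4]
    rw [← h1, neg_pow]
    have : ((-1 : F) ^ i) * (-1) ^ i = 1 := by rw [← mul_pow]; simp
    calc _ = ((-1 : F) ^ i * (-1) ^ i) * ((e.choose i : F)⁻¹ * (e.choose i : F)) * G x ^ i := by ring
      _ = _ := by rw [this, inv_mul_cancel₀ hc0]; ring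

theorem aux_ev_shift {F : Type*} [Field F] [Fintype F] (p n : ℕ) [Fact p.Prime]
    [CharP F p] [NeZero n] (hcard : Fintype.card F = p ^ n) (i : Fin n)
    (P : MvPolynomial (Fin n) F) (x : F) :
    aux_ev p n x (MvPolynomial.rename (fun l => l + i)
      (MvPolynomial.map (iterateFrobenius F p (i : ℕ)) P)) = (aux_ev p n x P) ^ p ^ (i : ℕ) := by
  have hfrob : ∀ l : Fin n, x ^ p ^ ((l + i : Fin n) : ℕ) = (x ^ p ^ (l : ℕ)) ^ p ^ (i : ℕ) := by
    intro l
    rw [← pow_mul, ← pow_add, Fin.val_add]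
    have hx : x ^ p ^ n = x := by rw [← hcard, FiniteField.pow_card]
    by_cases hlt : (l : ℕ) + i < n
    · rw [Nat.mod_eq_of_lt hlt]
    · have h2 : ((l : ℕ) + i) % n = l + i - n := by
        rw [Nat.mod_eq_sub_mod (by omega), Nat.mod_eq_of_lt (by omega)]
      have h3 : (l : ℕ) + i = n + (l + i - n) := by omega
      rw [h2]
      conv_rhs => rw [h3, pow_add, pow_mul, hx]
  induction P using MvPolynomial.induction_on with
  | C a => simp [aux_ev, iterateFrobenius_def]
  | add P Q hP hQ => simp only [map_add, hP, hQ, add_pow_char_pow]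
  | mul_X P l hP =>
    simp only [map_mul, hP, mul_pow]
    congr 1
    simp [aux_ev, hfrob]

theorem aux_carlitz {F : Type*} [Field F] [Fintype F] [DecidableEq F] (p n : ℕ) [Fact p.Prime]
    [CharP F p] [NeZero n] (hcard : Fintype.card F = p ^ n) (m : ℕ) (hm : 2 * m + 1 = p)
    (e : ℕ) (he : 2 * e + 1 = p ^ n) (he0 : 0 < e) (G : F → F)
    (hG : ∀ x y, (G x - G y) ^ e = (x - y) ^ e) :
    ∃ (s t : F) (h : ℕ), h < n ∧ ∀ x, G x = s * x ^ p ^ h + t := by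
  have hp : p.Prime := Fact.out
  have hm0 : 0 < m := by have := hp.two_le; omega
  have hn : 0 < n := Nat.pos_of_ne_zero (NeZero.ne n)
  have he' : 2 * e + 1 = p ^ (n - 1 + 1) := by rw [he]; congr 1; omega
  have hrep : ∀ i, ¬ p ∣ e.choose i → ∃ P : MvPolynomial (Fin n) F, (∀ j, P.degreeOf j ≤ m) ∧
      ∀ x, aux_ev p n x P = G x ^ i := by
    intro i hi
    refine aux_rep p n hcard m hm e he he0 G hG i ?_ hi
    by_contra hlt
    rw [Nat.choose_eq_zero_of_lt (by omega)] at hi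
    exact hi (dvd_zero p)
  -- two polynomials with small degrees and equal values agree
  have huniq : ∀ P Q : MvPolynomial (Fin n) F, (∀ j, P.degreeOf j ≤ 2 * m) →
      (∀ j, Q.degreeOf j ≤ 2 * m) → (∀ x, aux_ev p n x P = aux_ev p n x Q) → P = Q := by
    intro P Q hP hQ h
    rw [← sub_eq_zero]
    apply aux_ev_inj p n hcard
    · intro i
      have := MvPolynomial.degreeOf_sub_le i P Q
      have h1 := hP i
      have h2 := hQ i
      have : (P - Q).degreeOf i ≤ 2 * m := this.trans (max_le h1 h2)
      omega
    · intro x; rw [map_sub, h x, sub_self]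
  obtain ⟨P, hPd, hPe⟩ := hrep 1 (aux_choose1 p m hm _ e he' 1 hm0)
  have hpow : ∀ j, j ≤ m → ∀ l, (P ^ j).degreeOf l ≤ m := by
    intro j
    induction j with
    | zero => intro _ l; rw [pow_zero, ← MvPolynomial.C_1, MvPolynomial.degreeOf_C]; omega
    | succ j ih =>
      intro hj
      obtain ⟨R, hRd, hRe⟩ := hrep (j + 1) (aux_choose1 p m hm _ e he' (j + 1) hj)
      have : P ^ (j + 1) = R := by
        apply huniq
        · intro l
          rw [pow_succ]
          have h1 := MvPolynomial.degreeOf_mul_le l (P ^ j) P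
          have h2 := ih (by omega) l
          have h3 := hPd l
          omega
        · intro l; have := hRd l; omega
        · intro x; rw [map_pow, hPe, hRe, pow_one]
      rw [this]; exact hRd
  by_cases hP0 : P = 0
  · refine ⟨0, 0, 0, hn, fun x => ?_⟩
    have := hPe x
    rw [hP0, map_zero, pow_one] at this
    rw [← this]; simp
  have hdeg1 : ∀ l, P.degreeOf l ≤ 1 := by
    intro l
    have := hpow m le_rfl l
    rw [MvPolynomial.degreeOf_pow_eq l P m hP0] at this
    by_contra hlt
    nlinarith
  have hone : ∀ a b : Fin n, P.degreeOf a ≠ 0 → P.degreeOf b ≠ 0 → a = b := by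
    intro a b ha hb
    by_contra hab
    set i : Fin n := b - a with hi
    have hi0 : i ≠ 0 := sub_ne_zero.mpr (Ne.symm hab)
    have hi0' : 0 < (i : ℕ) := Nat.pos_of_ne_zero (fun h => hi0 (Fin.ext (by simpa using h)))
    have hinjs : Function.Injective (fun l : Fin n => l + i) := add_left_injective i
    set Q : MvPolynomial (Fin n) F := MvPolynomial.rename (fun l => l + i)
      (MvPolynomial.map (iterateFrobenius F p (i : ℕ)) P) with hQ
    have hQd : ∀ l, Q.degreeOf (l + i) = P.degreeOf l := by
      intro l
      rw [hQ, MvPolynomial.degreeOf_rename_of_injective hinjs, MvPolynomial.degreeOf_def,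
        MvPolynomial.degrees_map_of_injective _ (iterateFrobenius F p (i : ℕ)).injective,
        ← MvPolynomial.degreeOf_def]
    have hQ1 : ∀ l, Q.degreeOf l ≤ 1 := by
      intro l
      have := hQd (l - i)
      rw [sub_add_cancel] at this
      rw [this]; exact hdeg1 _
    have hQ0 : Q ≠ 0 := by
      intro h0
      have h1 := hQd a
      rw [h0] at h1
      simp at h1
      exact ha h1.symm
    obtain ⟨R, hRd, hRe⟩ := hrep (m + m * p ^ (i : ℕ))
      (aux_choose3 p m hm i n e he i.isLt hi0')
    have hPQ : ∀ l, (P ^ m * Q ^ m).degreeOf l = m * P.degreeOf l + m * Q.degreeOf l := by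
      intro l
      rw [MvPolynomial.degreeOf_mul_eq (pow_ne_zero _ hP0) (pow_ne_zero _ hQ0),
        MvPolynomial.degreeOf_pow_eq _ _ _ hP0, MvPolynomial.degreeOf_pow_eq _ _ _ hQ0]
    have hR : P ^ m * Q ^ m = R := by
      apply huniq
      · intro l
        rw [hPQ]
        have h1 := Nat.mul_le_mul_left m (hdeg1 l)
        have h2 := Nat.mul_le_mul_left m (hQ1 l)
        omega
      · intro l; have := hRd l; omega
      · intro x
        rw [map_mul, map_pow, map_pow, hQ, aux_ev_shift p n hcard, hPe, hRe, pow_one, pow_add,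
          ← pow_mul, mul_comm m]
    have hb2 := hRd b
    rw [← hR, hPQ] at hb2
    have h3 := hQd a
    rw [hi, add_sub_cancel] at h3
    have h4 : 1 ≤ P.degreeOf b := by omega
    have h5 : 1 ≤ Q.degreeOf b := by omega
    nlinarith
  obtain ⟨h, hh⟩ : ∃ h : Fin n, ∀ l, l ≠ h → P.degreeOf l = 0 := by
    by_cases hex : ∃ a, P.degreeOf a ≠ 0
    · obtain ⟨a, ha⟩ := hex
      refine ⟨a, fun l hl => ?_⟩
      by_contra h0
      exact hl (hone l a h0 ha)
    · push Not at hex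
      exact ⟨0, fun l _ => hex l⟩
  have hPform : P = MvPolynomial.C (P.coeff 0) +
      MvPolynomial.monomial (Finsupp.single h 1) (P.coeff (Finsupp.single h 1)) := by
    ext d
    rw [MvPolynomial.coeff_add, MvPolynomial.coeff_C, MvPolynomial.coeff_monomial]
    have h01 : (Finsupp.single h 1 : Fin n →₀ ℕ) ≠ 0 := by simp
    by_cases hd0 : d = 0
    · subst hd0; simp [h01]
    · by_cases hd1 : d = Finsupp.single h 1
      · subst hd1; simp [h01.symm]
      · rw [if_neg (Ne.symm hd0), if_neg (Ne.symm hd1), add_zero]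
        by_contra hne
        have hmem := MvPolynomial.mem_support_iff.mpr hne
        have hdl : ∀ l, l ≠ h → d l = 0 := fun l hl => by
          have := MvPolynomial.monomial_le_degreeOf l hmem
          rw [hh l hl] at this; omega
        have hdh : d h ≤ 1 := (MvPolynomial.monomial_le_degreeOf h hmem).trans (hdeg1 h)
        have hd : d = Finsupp.single h (d h) := by
          ext l
          by_cases hl : l = h
          · subst hl; simp
          · rw [hdl l hl, Finsupp.single_eq_of_ne hl]
        rcases Nat.le_one_iff_eq_zero_or_eq_one.mp hdh with h1 | h1
        · rw [h1, Finsupp.single_zero] at hd; exact hd0 hd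
        · rw [h1] at hd; exact hd1 hd
  refine ⟨P.coeff (Finsupp.single h 1), P.coeff 0, h, h.isLt, fun x => ?_⟩
  have := hPe x
  rw [pow_one] at this
  rw [← this]
  conv_lhs => rw [hPform]
  simp [aux_ev, MvPolynomial.eval_monomial, add_comm]

theorem aux_main_s14 {F : Type*} [Field F] [Fintype F] [DecidableEq F] (p n : ℕ) [Fact p.Prime]
    (hcard : Fintype.card F = p ^ n) (hodd : Odd (Fintype.card F)) (hq : 9 < Fintype.card F)
    (S : Finset F)
    (hS : (Fintype.card F : ℝ) - Real.sqrt (Fintype.card F) / 2 + 1 / 2 < (S.card : ℝ))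
    (g : F → F) (hg : ∀ x ∈ S, ∀ y ∈ S, ∃ z, g x - g y = (x - y) * z ^ 2) :
    ∃ (s t : F) (h : ℕ), h < n ∧ IsSquare s ∧ ∀ x ∈ S, g x = s * x ^ p ^ h + t := by
  have hn0 : n ≠ 0 := by rintro rfl; simp at hcard; omega
  haveI : NeZero n := ⟨hn0⟩
  haveI : CharP F p := charP_of_card_eq_prime_pow hcard
  have hp2 : Odd p := by
    rw [hcard] at hodd
    exact (Nat.odd_pow_iff hn0).mp hodd
  have hF : ringChar F ≠ 2 := by
    rw [ringChar.eq F p]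
    rintro rfl; exact absurd hp2 (by decide)
  obtain ⟨m, hm⟩ := hp2
  obtain ⟨e, he⟩ := hodd
  have he0 : 0 < e := by omega
  have hle : S.card ≤ Fintype.card F := Finset.card_le_univ S
  obtain ⟨k, hk⟩ := Nat.exists_eq_add_of_le hle
  have hk2 : (2 * k + 1) ^ 2 < Fintype.card F := by
    have h1 : (2 * (k : ℝ) + 1) < Real.sqrt (Fintype.card F) := by
      have : (Fintype.card F : ℝ) = S.card + k := by exact_mod_cast hk
      linarith
    have h2 := (Real.lt_sqrt (by positivity)).mp h1
    exact_mod_cast h2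
  have hsq : ∀ x ∈ S, ∀ y ∈ S, IsSquare ((g x - g y) * (x - y)) := by
    intro x hx y hy
    obtain ⟨z, hz⟩ := hg x hx y hy
    exact ⟨(x - y) * z, by rw [hz]; ring⟩
  rcases aux_const_or_inj hF S (by nlinarith) g hsq with ⟨t, ht⟩ | hinj
  · exact ⟨0, t, 0, Nat.pos_of_ne_zero hn0, IsSquare.zero, fun x hx => by rw [ht x hx]; ring⟩
  have hpow : ∀ x ∈ S, ∀ y ∈ S, (g x - g y) ^ e = (x - y) ^ e := by
    intro x hx y hy
    by_cases hxy : x = y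
    · subst hxy; simp
    have h1 : x - y ≠ 0 := sub_ne_zero.mpr hxy
    have h2 : g x - g y ≠ 0 := sub_ne_zero.mpr fun h => hxy (hinj hx hy h)
    obtain ⟨z, hz⟩ := hg x hx y hy
    have hz0 : z ≠ 0 := by
      rintro rfl
      apply h2; rw [hz]; simp
    rw [hz, mul_pow, ← pow_mul, mul_comm 2 e, pow_mul, aux_sq_pow e he.symm z hz0, mul_one]
  obtain ⟨G, hGg, hG⟩ := aux_extend p n hcard ⟨m, hm⟩ k (by rw [← hcard]; nlinarith) e
    (by rw [← hcard, he]) he0 S (by rw [← hcard, hk]) g hinj hpow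
  obtain ⟨s, t, h, hh, hst⟩ := aux_carlitz p n hcard m hm.symm e (by rw [← hcard, he]) he0 G hG
  refine ⟨s, t, h, hh, ?_, fun x hx => by rw [← hGg x hx, hst]⟩
  have h1 := hG 1 0
  rw [hst, hst, sub_zero, one_pow, one_pow,
    zero_pow (pow_ne_zero _ (Fact.out : p.Prime).ne_zero)] at h1
  have h2 : s ^ e = 1 := by rw [← h1]; congr 1; ring
  have hs0 : s ≠ 0 := by rintro rfl; rw [zero_pow he0.ne'] at h2; exact zero_ne_one h2
  rw [FiniteField.isSquare_iff hF hs0, show Fintype.card F / 2 = e by omega]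
  exact h2


/-- Let `q = p^n > 9` be odd and `U` an intersecting family of polynomials over `F_q` of
degree at most `2`. For `b ∈ F_q` let `C_b = {c : ∃ a, a + bx + cx² ∈ U}` and let
`doM = {b : |C_b| > q − √q/2 + 1/2}`. Then there are functions `s, t : F_q → F_q` and
`h : F_q → {0, …, n−1}` such that for every `b ∈ doM` and every `c ∈ C_b`, the constant
term `a` of the member `a + bx + cx²` of `U` equals `s(b)·c^{p^{h(b)}} + t(b)`, and `−s(b)`
is a square in `F_q`. -/
theorem stmt14 (p n : ℕ) [Fact p.Prime] (F : Type*) [Field F] [Fintype F]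
    (hcard : Fintype.card F = p ^ n)
    (hodd : Odd (Fintype.card F)) (hq : 9 < Fintype.card F)
    (U : Set (Polynomial F)) (hdeg : ∀ f ∈ U, f.natDegree ≤ 2)
    (hint : ∀ f ∈ U, ∀ g ∈ U, ∃ x : F, f.eval x = g.eval x) :
    ∃ (s t : F → F) (h : F → ℕ),
      ∀ b : F,
        (Fintype.card F : ℝ) - Real.sqrt (Fintype.card F) / 2 + 1 / 2 <
          ({c : F | ∃ a : F, C a + C b * X + C c * X ^ 2 ∈ U}.ncard : ℝ) →
        h b < n ∧ IsSquare (-(s b)) ∧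
          ∀ c a : F, C a + C b * X + C c * X ^ 2 ∈ U →
            a = s b * c ^ p ^ (h b) + t b := by
  classical
  have key : ∀ b : F, ∃ (s t : F) (h : ℕ),
      (Fintype.card F : ℝ) - Real.sqrt (Fintype.card F) / 2 + 1 / 2 <
          ({c : F | ∃ a : F, C a + C b * X + C c * X ^ 2 ∈ U}.ncard : ℝ) →
        h < n ∧ IsSquare (-s) ∧
          ∀ c a : F, C a + C b * X + C c * X ^ 2 ∈ U → a = s * c ^ p ^ h + t := by
    intro b
    by_cases hb : (Fintype.card F : ℝ) - Real.sqrt (Fintype.card F) / 2 + 1 / 2 <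
          ({c : F | ∃ a : F, C a + C b * X + C c * X ^ 2 ∈ U}.ncard : ℝ)
    swap
    · exact ⟨0, 0, 0, fun h => absurd h hb⟩
    have hdiff : ∀ c a c' a' : F, C a + C b * X + C c * X ^ 2 ∈ U →
        C a' + C b * X + C c' * X ^ 2 ∈ U → ∃ z, -a - -a' = (c - c') * z ^ 2 := by
      intro c a c' a' h h'
      obtain ⟨z, hz⟩ := hint _ h _ h'
      simp only [eval_add, eval_mul, eval_C, eval_X, eval_pow] at hz
      exact ⟨z, by linear_combination -hz⟩
    have hex : ∀ c : F, ∃ a : F, (∃ a' : F, C a' + C b * X + C c * X ^ 2 ∈ U) →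
        C a + C b * X + C c * X ^ 2 ∈ U := by
      intro c
      by_cases h : ∃ a' : F, C a' + C b * X + C c * X ^ 2 ∈ U
      · obtain ⟨a, ha⟩ := h; exact ⟨a, fun _ => ha⟩
      · exact ⟨0, fun h' => absurd h' h⟩
    choose α hα using hex
    rw [Set.ncard_eq_toFinset_card'] at hb
    obtain ⟨s, t, h, hh, hs, hst⟩ := aux_main_s14 p n hcard hodd hq _ hb (fun c => - α c) (by
      intro x hx y hy
      rw [Set.mem_toFinset] at hx hy
      exact hdiff x _ y _ (hα x hx) (hα y hy))
    refine ⟨-s, -t, h, fun _ => ⟨hh, by rwa [neg_neg], fun c a hca => ?_⟩⟩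
    have h1 := hst c (by rw [Set.mem_toFinset]; exact ⟨a, hca⟩)
    obtain ⟨z, hz⟩ := hdiff c a c (α c) hca (hα c ⟨a, hca⟩)
    linear_combination -hz - h1
  choose s t h H using key
  exact ⟨s, t, h, H⟩
end
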